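/- arXiv:0908.0558 — 2 statements merged into one kernel-verified Lean document; each statement's English description precedes it below -/
import Mathlib

section
/- The function H̃_n(t) := H_n(t) + d₁t + d₂, where d₁ = −n(n+α+β+γ) − (α+β)²/4 and d₂ = (1/4)[2n(n+α+β+γ) + β(α+β) − γ(α−β)], satisfies the Jimbo–Miwa–Okamoto σ-form of Painlevé VI: H̃_n′·(t(t−1)H̃_n″)² + {2H̃_n′(tH̃_n′ − H̃_n) − (H̃_n′)² − ν₁ν₂ν₃ν₄}² = (H̃_n′ + ν₁²)(H̃_n′ + ν₂²)(H̃_n′ + ν₃²)(H̃_n′ + ν₄²) for all t < 0, where ν₁ = (α+β)/2, ν₂ = (β−α)/2, ν₃ = (2n+α+β)/2, ν₄ = (2n+α+β+2γ)/2. -/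
open MeasureTheory Real

/-- The generalized Jacobi weight `w(x;t) = (x-t)^γ x^α (1-x)^β`. -/
noncomputable def genJacobiWeight (α β γ t x : ℝ) : ℝ :=
  (x - t) ^ γ * x ^ α * (1 - x) ^ β

/-- The Hankel determinant `D_n(t)` of the moments of the generalized Jacobi weight. -/
noncomputable def hankelDet (α β γ : ℝ) (n : ℕ) (t : ℝ) : ℝ :=
  Matrix.det (Matrix.of fun j k : Fin n =>
    ∫ x in (0:ℝ)..1, x ^ ((j : ℕ) + (k : ℕ)) * genJacobiWeight α β γ t x)

section MomentFunctional

open Polynomial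

/-- The linear functional on real polynomials with moments `m`. -/
noncomputable def momentFunctional (m : ℕ → ℝ) : ℝ[X] →ₗ[ℝ] ℝ :=
  Polynomial.lsum fun k => m k • LinearMap.id

@[simp]
lemma momentFunctional_monomial (m : ℕ → ℝ) (k : ℕ) (a : ℝ) :
    momentFunctional m (monomial k a) = m k * a := by
  simp [momentFunctional, Polynomial.lsum_apply]

@[simp]
lemma momentFunctional_C_mul (m : ℕ → ℝ) (a : ℝ) (f : ℝ[X]) :
    momentFunctional m (C a * f) = a * momentFunctional m f := by
  rw [← smul_eq_C_mul, map_smul, smul_eq_mul]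

/-- The evaluation functional has geometric moments. -/
lemma momentFunctional_pow (x : ℝ) (f : ℝ[X]) :
    momentFunctional (fun k => x ^ k) f = f.eval x := by
  induction f using Polynomial.induction_on' with
  | add p q hp hq => simp only [map_add, hp, hq, eval_add]
  | monomial k b => simp [mul_comm]

/-- The Hankel matrix of a moment sequence. -/
def hankelMatrix (n : ℕ) (m : ℕ → ℝ) : Matrix (Fin n) (Fin n) ℝ :=
  Matrix.of fun i j => m (i + j)

@[simp]
lemma hankelMatrix_apply (n : ℕ) (m : ℕ → ℝ) (i j : Fin n) :
    hankelMatrix n m i j = m (i + j) := rfl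

lemma hankelMatrix_transpose (n : ℕ) (m : ℕ → ℝ) :
    (hankelMatrix n m).transpose = hankelMatrix n m := by
  ext i j
  simp [add_comm]

/-- The polynomial of degree less than `n` with coefficient vector `v`. -/
noncomputable def ofCoeffs {n : ℕ} (v : Fin n → ℝ) : ℝ[X] :=
  ∑ i : Fin n, monomial (i : ℕ) (v i)

lemma coeff_ofCoeffs {n : ℕ} (v : Fin n → ℝ) (i : Fin n) : (ofCoeffs v).coeff i = v i := by
  simp only [ofCoeffs, finsetSum_coeff, coeff_monomial]
  rw [Finset.sum_eq_single i] <;> simp +contextual [Fin.ext_iff]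

lemma degree_ofCoeffs_lt {n : ℕ} (v : Fin n → ℝ) : (ofCoeffs v).degree < n := by
  rw [ofCoeffs, ← mem_degreeLT]
  exact Submodule.sum_mem _ fun i _ =>
    mem_degreeLT.2 ((degree_monomial_le _ _).trans_lt (by exact_mod_cast i.2))

lemma ofCoeffs_coeff {n : ℕ} {f : ℝ[X]} (hf : f.degree < n) :
    ofCoeffs (fun i : Fin n => f.coeff i) = f := by
  ext k
  rcases lt_or_ge k n with hk | hk
  · exact coeff_ofCoeffs (fun i : Fin n => f.coeff i) ⟨k, hk⟩
  · rw [(degree_lt_iff_coeff_zero _ _).1 (degree_ofCoeffs_lt _) k hk,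
      (degree_lt_iff_coeff_zero _ _).1 hf k hk]

lemma eval_ofCoeffs {n : ℕ} (v : Fin n → ℝ) (x : ℝ) :
    (ofCoeffs v).eval x = ∑ i : Fin n, v i * x ^ (i : ℕ) := by
  simp [ofCoeffs, eval_finsetSum]

lemma momentFunctional_ofCoeffs {n : ℕ} (m : ℕ → ℝ) (v : Fin n → ℝ) :
    momentFunctional m (ofCoeffs v) = v ⬝ᵥ fun i => m i := by
  simp [ofCoeffs, dotProduct, mul_comm]

lemma momentFunctional_ofCoeffs_mul {n : ℕ} (m : ℕ → ℝ) (v w : Fin n → ℝ) :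
    momentFunctional m (ofCoeffs v * ofCoeffs w)
      = v ⬝ᵥ (hankelMatrix n m).mulVec w := by
  rw [ofCoeffs, ofCoeffs, Finset.sum_mul_sum]
  simp only [monomial_mul_monomial, map_sum, momentFunctional_monomial, dotProduct, Matrix.mulVec,
    Finset.mul_sum, hankelMatrix_apply]
  exact Finset.sum_congr rfl fun i _ => Finset.sum_congr rfl fun j _ => by ring

/-- The polynomial of degree less than `n` representing the functional with moments `l`
with respect to the bilinear form with moments `m`. -/
noncomputable def rieszPoly (n : ℕ) (m l : ℕ → ℝ) : ℝ[X] :=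
  ofCoeffs ((hankelMatrix n m)⁻¹.mulVec fun i : Fin n => l i)

lemma degree_rieszPoly_lt (n : ℕ) (m l : ℕ → ℝ) : (rieszPoly n m l).degree < n :=
  degree_ofCoeffs_lt _

lemma momentFunctional_rieszPoly_mul {n : ℕ} {m : ℕ → ℝ} (l : ℕ → ℝ)
    (hm : (hankelMatrix n m).det ≠ 0) {f : ℝ[X]} (hf : f.degree < n) :
    momentFunctional m (rieszPoly n m l * f) = momentFunctional l f := by
  rw [← ofCoeffs_coeff hf, mul_comm, rieszPoly, momentFunctional_ofCoeffs_mul,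
    Matrix.mulVec_mulVec, Matrix.mul_nonsing_inv _ (isUnit_iff_ne_zero.2 hm), Matrix.one_mulVec,
    momentFunctional_ofCoeffs]

lemma eq_of_momentFunctional_mul_eq {n : ℕ} {m : ℕ → ℝ} (hm : (hankelMatrix n m).det ≠ 0)
    {p q : ℝ[X]} (hp : p.degree < n) (hq : q.degree < n)
    (h : ∀ f : ℝ[X], f.degree < n → momentFunctional m (p * f) = momentFunctional m (q * f)) :
    p = q := by
  have key : (hankelMatrix n m).mulVec (fun i : Fin n => p.coeff i)
      = (hankelMatrix n m).mulVec (fun i : Fin n => q.coeff i) := by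
    refine dotProduct_eq _ _ fun v => ?_
    have := h (ofCoeffs v) (degree_ofCoeffs_lt v)
    rw [← ofCoeffs_coeff hp, ← ofCoeffs_coeff hq, mul_comm, mul_comm (ofCoeffs _) (ofCoeffs v),
      momentFunctional_ofCoeffs_mul, momentFunctional_ofCoeffs_mul] at this
    rw [dotProduct_comm, this, dotProduct_comm]
  have hinj := Matrix.mulVec_injective_of_isUnit
    ((Matrix.isUnit_iff_isUnit_det _).2 (isUnit_iff_ne_zero.2 hm)) key
  rw [← ofCoeffs_coeff hp, ← ofCoeffs_coeff hq, hinj]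

lemma degree_divByMonic_X_sub_C_lt {n : ℕ} {f : ℝ[X]} (c : ℝ) (hf : f.degree ≤ n) :
    (f /ₘ (X - C c)).degree < n := by
  rcases eq_or_ne f 0 with rfl | h0
  · simp
  · exact (degree_divByMonic_lt _ _ h0 (by simp)).trans_le hf

lemma sub_C_eval_eq_mul_divByMonic (f : ℝ[X]) (c : ℝ) :
    f = C (f.eval c) + (X - C c) * (f /ₘ (X - C c)) := by
  rw [← modByMonic_X_sub_C_eq_C_eval, modByMonic_add_div]

lemma momentFunctional_X_sub_C_mul {m u : ℕ → ℝ} {c : ℝ} (hu : ∀ k, u (k + 1) = c * u k + m k)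
    (f : ℝ[X]) : momentFunctional u ((X - C c) * f) = momentFunctional m f := by
  induction f using Polynomial.induction_on' with
  | add p q hp hq => simp only [mul_add, map_add, hp, hq]
  | monomial k b =>
    rw [sub_mul, map_sub, X_mul_monomial, C_mul_monomial]
    simp only [momentFunctional_monomial, hu]
    ring

lemma momentFunctional_mul_split {m u : ℕ → ℝ} {c : ℝ} (hu : ∀ k, u (k + 1) = c * u k + m k)
    (f h : ℝ[X]) :
    momentFunctional u (f * h)
      = f.eval c * momentFunctional u h + momentFunctional m ((f /ₘ (X - C c)) * h) := by
  conv_lhs => rw [sub_C_eval_eq_mul_divByMonic f c]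
  rw [add_mul, map_add, momentFunctional_C_mul, mul_assoc, momentFunctional_X_sub_C_mul hu]

end MomentFunctional

section Pearson

open Polynomial

/-- Moment data of a weight with logarithmic derivative `∑ i, g i / (x - c i)`: `m` are the moments
of the weight and `u i` the moments of the weight divided by `x - c i`. -/
structure IsPearson {ι : Type*} [Fintype ι] (c g : ι → ℝ) (m : ℕ → ℝ) (u : ι → ℕ → ℝ) : Prop where
  shift : ∀ i k, u i (k + 1) = c i * u i k + m k
  pearson : ∀ k : ℕ, k * m (k - 1) = -∑ i, g i * u i k

variable {ι : Type*} [Fintype ι] {c g : ι → ℝ} {m : ℕ → ℝ} {u : ι → ℕ → ℝ}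

lemma IsPearson.momentFunctional_derivative (h : IsPearson c g m u) (f : ℝ[X]) :
    momentFunctional m (derivative f) = -∑ i, g i * momentFunctional (u i) f := by
  induction f using Polynomial.induction_on' with
  | add p q hp hq =>
    simp only [map_add, hp, hq, mul_add, Finset.sum_add_distrib]
    ring
  | monomial k b =>
    rw [derivative_monomial]
    simp only [momentFunctional_monomial]
    have := h.pearson k
    simp only [← mul_assoc, ← Finset.sum_mul]
    linear_combination b * this

/-- The kernel `G(x, c_i) = 1 - (x - c_i) Φ_i(x)` with `Φ_i` representing the functional `u i`. -/
noncomputable def pearsonKernel {ι : Type*} (n : ℕ) (c : ι → ℝ) (m : ℕ → ℝ) (u : ι → ℕ → ℝ)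
    (i j : ι) : ℝ :=
  1 - (c i - c j) * (rieszPoly n m (u j)).eval (c i)

/-- The monic orthogonal polynomial of degree `n`. -/
noncomputable def orthoPoly (n : ℕ) (m : ℕ → ℝ) : ℝ[X] :=
  X ^ n - rieszPoly n m fun k => m (n + k)

/-- The polynomial of degree less than `n` representing the leading coefficient functional. -/
noncomputable def leadPoly (n : ℕ) (m : ℕ → ℝ) : ℝ[X] :=
  rieszPoly n m fun k => if k = n - 1 then 1 else 0

lemma coeff_eq_momentFunctional (k : ℕ) (f : ℝ[X]) :
    momentFunctional (fun j => if j = k then 1 else 0) f = f.coeff k := by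
  induction f using Polynomial.induction_on' with
  | add p q hp hq => simp only [map_add, hp, hq, coeff_add]
  | monomial j b => simp [coeff_monomial]

variable {n : ℕ}

lemma momentFunctional_leadPoly_mul (hm : (hankelMatrix n m).det ≠ 0) {f : ℝ[X]}
    (hf : f.degree < n) : momentFunctional m (leadPoly n m * f) = f.coeff (n - 1) := by
  rw [leadPoly, momentFunctional_rieszPoly_mul _ hm hf, coeff_eq_momentFunctional]

lemma momentFunctional_X_pow_mul (m : ℕ → ℝ) (n : ℕ) (f : ℝ[X]) :
    momentFunctional m (X ^ n * f) = momentFunctional (fun k => m (n + k)) f := by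
  induction f using Polynomial.induction_on' with
  | add p q hp hq => simp only [mul_add, map_add, hp, hq]
  | monomial j b => simp [X_pow_mul_monomial, add_comm]

lemma momentFunctional_orthoPoly_mul (hm : (hankelMatrix n m).det ≠ 0) {f : ℝ[X]}
    (hf : f.degree < n) : momentFunctional m (orthoPoly n m * f) = 0 := by
  rw [orthoPoly, sub_mul, map_sub, momentFunctional_rieszPoly_mul _ hm hf,
    momentFunctional_X_pow_mul, sub_self]

lemma coeff_orthoPoly_self : (orthoPoly n m).coeff n = 1 := by
  simp [orthoPoly, (degree_lt_iff_coeff_zero _ _).1 (degree_rieszPoly_lt n m _) n le_rfl]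

lemma coeff_orthoPoly_of_lt {k : ℕ} (hk : n < k) : (orthoPoly n m).coeff k = 0 := by
  simp [orthoPoly, (degree_lt_iff_coeff_zero _ _).1 (degree_rieszPoly_lt n m _) k hk.le,
    coeff_X_pow, hk.ne']

lemma degree_orthoPoly_le : (orthoPoly n m).degree ≤ n :=
  (degree_le_iff_coeff_zero _ _).2 fun k hk => coeff_orthoPoly_of_lt (by exact_mod_cast hk)

lemma degree_derivative_orthoPoly_lt : (derivative (orthoPoly n m)).degree < n := by
  rw [degree_lt_iff_coeff_zero]
  intro k hk
  rw [coeff_derivative, coeff_orthoPoly_of_lt (by omega), zero_mul]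

lemma coeff_derivative_of_degree_lt (hn : 0 < n) {f : ℝ[X]} (hf : f.degree < n) :
    (derivative f).coeff (n - 1) = 0 := by
  rw [coeff_derivative, (degree_lt_iff_coeff_zero _ _).1 hf _ (by omega), zero_mul]

lemma coeff_divByMonic_X_sub_C_of_degree_lt (hn : 0 < n) {f : ℝ[X]} (hf : f.degree < n) (a : ℝ) :
    (f /ₘ (X - C a)).coeff (n - 1) = 0 := by
  rw [coeff_divByMonic_X_sub_C]
  refine Finset.sum_eq_zero fun i hi => ?_
  rw [(degree_lt_iff_coeff_zero _ _).1 hf i (by have := (Finset.mem_Icc.1 hi).1; omega), mul_zero]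

lemma degree_derivative_lt_of_degree_lt {f : ℝ[X]} (hf : f.degree < n) :
    (derivative f).degree < n :=
  degree_derivative_le.trans_lt hf

lemma degree_X_sub_C_mul_sub_orthoPoly_lt (hn : 0 < n) (a : ℝ) {f : ℝ[X]} (hf : f.degree < n) :
    ((X - C a) * f - C (f.coeff (n - 1)) * orthoPoly n m).degree < (n : WithBot ℕ) := by
  rw [degree_lt_iff_coeff_zero]
  intro j hj
  obtain ⟨i, rfl⟩ : ∃ i, j = i + 1 := ⟨j - 1, by omega⟩
  have h1 : f.coeff (i + 1) = 0 := (degree_lt_iff_coeff_zero _ _).1 hf _ hj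
  simp only [coeff_sub, sub_mul, coeff_X_mul, coeff_C_mul, h1]
  rcases hj.eq_or_lt with h | h
  · have hi : i = n - 1 := by omega
    rw [← h, coeff_orthoPoly_self, hi]
    simp
  · rw [coeff_orthoPoly_of_lt h, (degree_lt_iff_coeff_zero _ _).1 hf i (by omega)]
    simp

/-- Christoffel–Darboux type factorisation for a functional with `(x - a) u = m`. -/
lemma one_sub_X_sub_C_mul_rieszPoly (hn : 0 < n) (hm : (hankelMatrix n m).det ≠ 0)
    {v : ℕ → ℝ} {a : ℝ} (hv : ∀ k, v (k + 1) = a * v k + m k) :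
    1 - (X - C a) * rieszPoly n m v
      = C (momentFunctional v (orthoPoly n m)) * leadPoly n m
        - C (momentFunctional v (leadPoly n m)) * orthoPoly n m := by
  set P := orthoPoly n m with hP
  set k := leadPoly n m with hk
  set Φ := rieszPoly n m v with hΦ
  have hΦd : Φ.degree < n := degree_rieszPoly_lt _ _ _
  have hkd : k.degree < n := degree_rieszPoly_lt _ _ _
  have hlead : Φ.coeff (n - 1) = momentFunctional v k := by
    rw [← momentFunctional_leadPoly_mul hm hΦd, mul_comm, momentFunctional_rieszPoly_mul _ hm hkd]
  have key : 1 - (X - C a) * Φ + C (momentFunctional v k) * P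
      = C (momentFunctional v P) * k := by
    refine eq_of_momentFunctional_mul_eq hm ?_ ?_ ?_
    · have h1 : 1 - (X - C a) * Φ + C (momentFunctional v k) * P
          = 1 - ((X - C a) * Φ - C (Φ.coeff (n - 1)) * P) := by rw [hlead]; ring
      rw [h1]
      refine (degree_sub_le _ _).trans_lt (max_lt ?_ (degree_X_sub_C_mul_sub_orthoPoly_lt hn a hΦd))
      rw [degree_one]
      exact_mod_cast hn
    · rw [← smul_eq_C_mul]
      exact (degree_smul_le _ _).trans_lt hkd
    · intro f hf
      rw [mul_assoc, momentFunctional_C_mul, momentFunctional_leadPoly_mul hm hf, add_mul, map_add,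
        mul_assoc (C _) P f, momentFunctional_C_mul, momentFunctional_orthoPoly_mul hm hf, mul_zero,
        add_zero, sub_mul, map_sub, one_mul]
      have hr := degree_X_sub_C_mul_sub_orthoPoly_lt (m := m) hn a hf
      have h2 := momentFunctional_rieszPoly_mul v hm hr
      have h3 : Φ * ((X - C a) * f - C (f.coeff (n - 1)) * P)
          = (X - C a) * Φ * f - C (f.coeff (n - 1)) * (P * Φ) := by ring
      rw [← hΦ, ← hP, h3, map_sub, map_sub, momentFunctional_C_mul, momentFunctional_C_mul,
        momentFunctional_orthoPoly_mul hm hΦd, momentFunctional_X_sub_C_mul hv] at h2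
      linear_combination -h2
  linear_combination key

/-- The reproducing kernel polynomial at `x`. -/
noncomputable def reproPoly (n : ℕ) (m : ℕ → ℝ) (x : ℝ) : ℝ[X] := rieszPoly n m fun k => x ^ k

lemma momentFunctional_reproPoly_mul (hm : (hankelMatrix n m).det ≠ 0) (x : ℝ) {f : ℝ[X]}
    (hf : f.degree < n) : momentFunctional m (reproPoly n m x * f) = f.eval x := by
  rw [reproPoly, momentFunctional_rieszPoly_mul _ hm hf, momentFunctional_pow]

/-- The Christoffel–Darboux formula. -/
lemma C_sub_X_mul_reproPoly (hn : 0 < n) (hm : (hankelMatrix n m).det ≠ 0) (x : ℝ) :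
    (C x - X) * reproPoly n m x
      = C ((orthoPoly n m).eval x) * leadPoly n m
        - C ((leadPoly n m).eval x) * orthoPoly n m := by
  set P := orthoPoly n m with hP
  set k := leadPoly n m with hk
  set A := reproPoly n m x with hA
  have hAd : A.degree < n := degree_rieszPoly_lt _ _ _
  have hkd : k.degree < n := degree_rieszPoly_lt _ _ _
  have hlead : A.coeff (n - 1) = k.eval x := by
    rw [← momentFunctional_leadPoly_mul hm hAd, mul_comm, momentFunctional_reproPoly_mul hm x hkd]
  have key : (C x - X) * A + C (k.eval x) * P = C (P.eval x) * k := by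
    refine eq_of_momentFunctional_mul_eq hm ?_ ?_ ?_
    · have h1 : (C x - X) * A + C (k.eval x) * P
          = -((X - C x) * A - C (A.coeff (n - 1)) * P) := by rw [hlead]; ring
      rw [h1, degree_neg]
      exact degree_X_sub_C_mul_sub_orthoPoly_lt hn x hAd
    · rw [← smul_eq_C_mul]
      exact (degree_smul_le _ _).trans_lt hkd
    · intro f hf
      rw [mul_assoc, momentFunctional_C_mul, momentFunctional_leadPoly_mul hm hf, add_mul, map_add,
        mul_assoc (C _) P f, momentFunctional_C_mul, momentFunctional_orthoPoly_mul hm hf, mul_zero,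
        add_zero]
      have hr := degree_X_sub_C_mul_sub_orthoPoly_lt (m := m) hn x hf
      have h2 := momentFunctional_reproPoly_mul hm x hr
      have h3 : A * ((X - C x) * f - C (f.coeff (n - 1)) * P)
          = -((C x - X) * A * f) - C (f.coeff (n - 1)) * (P * A) := by ring
      rw [← hA, ← hP, h3, map_sub, map_neg, momentFunctional_C_mul,
        momentFunctional_orthoPoly_mul hm hAd] at h2
      simp only [eval_mul, eval_sub, eval_C, eval_X, sub_self, zero_mul, mul_zero] at h2
      linear_combination -h2
  linear_combination key

lemma momentFunctional_mul_orthoPoly (hm : (hankelMatrix n m).det ≠ 0)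
    {v : ℕ → ℝ} {a : ℝ} (hv : ∀ k, v (k + 1) = a * v k + m k) {f : ℝ[X]} (hf : f.degree ≤ n) :
    momentFunctional v (f * orthoPoly n m) = f.eval a * momentFunctional v (orthoPoly n m) := by
  rw [momentFunctional_mul_split hv, mul_comm (f /ₘ _),
    momentFunctional_orthoPoly_mul hm (degree_divByMonic_X_sub_C_lt a hf), add_zero]

lemma momentFunctional_mul_leadPoly (hn : 0 < n) (hm : (hankelMatrix n m).det ≠ 0)
    {v : ℕ → ℝ} {a : ℝ} (hv : ∀ k, v (k + 1) = a * v k + m k) {f : ℝ[X]} (hf : f.degree < n) :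
    momentFunctional v (f * leadPoly n m) = f.eval a * momentFunctional v (leadPoly n m) := by
  rw [momentFunctional_mul_split hv, mul_comm (f /ₘ _),
    momentFunctional_leadPoly_mul hm (degree_divByMonic_X_sub_C_lt a hf.le),
    coeff_divByMonic_X_sub_C_of_degree_lt hn hf, add_zero]

lemma IsPearson.derivative_orthoPoly (h : IsPearson c g m u)
    (hm : (hankelMatrix n m).det ≠ 0) :
    derivative (orthoPoly n m)
      = -∑ i, C (g i * momentFunctional (u i) (orthoPoly n m)) * reproPoly n m (c i) := by
  refine eq_of_momentFunctional_mul_eq hm degree_derivative_orthoPoly_lt ?_ ?_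
  · rw [degree_neg, ← mem_degreeLT]
    refine Submodule.sum_mem _ fun i _ => ?_
    rw [← smul_eq_C_mul]
    exact Submodule.smul_mem _ _ (mem_degreeLT.2 (degree_rieszPoly_lt _ _ _))
  · intro f hf
    have h1 := h.momentFunctional_derivative (f * orthoPoly n m)
    rw [derivative_mul, map_add, mul_comm (derivative f),
      momentFunctional_orthoPoly_mul hm (degree_derivative_lt_of_degree_lt hf), zero_add] at h1
    rw [mul_comm, h1, neg_mul, map_neg, Finset.sum_mul, map_sum]
    refine congrArg _ (Finset.sum_congr rfl fun i _ => ?_)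
    rw [mul_assoc, momentFunctional_C_mul, momentFunctional_reproPoly_mul hm _ hf,
      momentFunctional_mul_orthoPoly hm (h.shift i) hf.le]
    ring

lemma IsPearson.derivative_leadPoly (h : IsPearson c g m u) (hn : 0 < n)
    (hm : (hankelMatrix n m).det ≠ 0) :
    derivative (leadPoly n m)
      = -∑ i, C (g i * momentFunctional (u i) (leadPoly n m)) * reproPoly n m (c i) := by
  refine eq_of_momentFunctional_mul_eq hm
    (degree_derivative_lt_of_degree_lt (degree_rieszPoly_lt _ _ _)) ?_ ?_
  · rw [degree_neg, ← mem_degreeLT]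
    refine Submodule.sum_mem _ fun i _ => ?_
    rw [← smul_eq_C_mul]
    exact Submodule.smul_mem _ _ (mem_degreeLT.2 (degree_rieszPoly_lt _ _ _))
  · intro f hf
    have h1 := h.momentFunctional_derivative (f * leadPoly n m)
    rw [derivative_mul, map_add, mul_comm (derivative f),
      momentFunctional_leadPoly_mul hm (degree_derivative_lt_of_degree_lt hf),
      coeff_derivative_of_degree_lt hn hf, zero_add] at h1
    rw [mul_comm, h1, neg_mul, map_neg, Finset.sum_mul, map_sum]
    refine congrArg _ (Finset.sum_congr rfl fun i _ => ?_)
    rw [mul_assoc, momentFunctional_C_mul, momentFunctional_reproPoly_mul hm _ hf,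
      momentFunctional_mul_leadPoly hn hm (h.shift i) hf]
    ring

lemma IsPearson.pearsonKernel_eq (h : IsPearson c g m u) (hn : 0 < n)
    (hm : (hankelMatrix n m).det ≠ 0) (i j : ι) :
    pearsonKernel n c m u i j
      = (leadPoly n m).eval (c i) * momentFunctional (u j) (orthoPoly n m)
        - (orthoPoly n m).eval (c i) * momentFunctional (u j) (leadPoly n m) := by
  have := congrArg (eval (c i)) (one_sub_X_sub_C_mul_rieszPoly hn hm (h.shift j))
  simp only [eval_sub, eval_mul, eval_one, eval_X, eval_C] at this
  rw [pearsonKernel, this]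
  ring

lemma pearsonKernel_self {ι : Type*} {c : ι → ℝ} {u : ι → ℕ → ℝ} (i : ι) :
    pearsonKernel n c m u i i = 1 := by simp [pearsonKernel]

/-- The kernel has rank at most two. -/
lemma IsPearson.pearsonKernel_det (h : IsPearson c g m u) (hn : 0 < n)
    (hm : (hankelMatrix n m).det ≠ 0) (i j k : ι) :
    pearsonKernel n c m u i j * pearsonKernel n c m u j k * pearsonKernel n c m u k i
      + pearsonKernel n c m u i k * pearsonKernel n c m u k j * pearsonKernel n c m u j i
      = pearsonKernel n c m u i j * pearsonKernel n c m u j i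
        + pearsonKernel n c m u i k * pearsonKernel n c m u k i
        + pearsonKernel n c m u j k * pearsonKernel n c m u k j - 1 := by
  have hi := pearsonKernel_self (n := n) (c := c) (m := m) (u := u) i
  have hj := pearsonKernel_self (n := n) (c := c) (m := m) (u := u) j
  have hk := pearsonKernel_self (n := n) (c := c) (m := m) (u := u) k
  suffices hdet : pearsonKernel n c m u i j * pearsonKernel n c m u j k * pearsonKernel n c m u k i
      + pearsonKernel n c m u i k * pearsonKernel n c m u k j * pearsonKernel n c m u j i
      = pearsonKernel n c m u i j * pearsonKernel n c m u j i * pearsonKernel n c m u k k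
        + pearsonKernel n c m u i k * pearsonKernel n c m u k i * pearsonKernel n c m u j j
        + pearsonKernel n c m u j k * pearsonKernel n c m u k j * pearsonKernel n c m u i i
        - pearsonKernel n c m u i i * pearsonKernel n c m u j j * pearsonKernel n c m u k k by
    rw [hdet, hi, hj, hk]
    ring
  simp only [h.pearsonKernel_eq hn hm]
  ring

/-- The residue at infinity gives a quadratic constraint on the kernel. -/
lemma IsPearson.sum_pearsonKernel_mul (h : IsPearson c g m u) (hn : 0 < n)
    (hm : (hankelMatrix n m).det ≠ 0) :
    ∑ i, ∑ j, g i * g j * (pearsonKernel n c m u i j * pearsonKernel n c m u j i)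
      = (n : ℝ) ^ 2 + (n + ∑ i, g i) ^ 2 := by
  have hkd : (leadPoly n m).degree < n := degree_rieszPoly_lt _ _ _
  set P := orthoPoly n m with hP
  set k := leadPoly n m with hk
  have hlead : (derivative P).coeff (n - 1) = n := by
    rw [coeff_derivative, Nat.sub_add_cancel hn, hP, coeff_orthoPoly_self, one_mul]
    exact_mod_cast Nat.sub_add_cancel hn
  have hkP : ∑ i, g i * momentFunctional (u i) (k * P) = -n := by
    have h1 := h.momentFunctional_derivative (k * P)
    rw [derivative_mul, map_add, mul_comm (derivative k),
      momentFunctional_orthoPoly_mul hm (degree_derivative_lt_of_degree_lt hkd),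
      momentFunctional_leadPoly_mul hm degree_derivative_orthoPoly_lt, hlead] at h1
    linarith
  have hkq : ∑ i, g i * (k.eval (c i) * momentFunctional (u i) P) = -n := by
    rw [← hkP]
    exact Finset.sum_congr rfl fun i _ => by
      rw [momentFunctional_mul_orthoPoly hm (h.shift i) hkd.le]
  have hPq : ∑ i, g i * (P.eval (c i) * momentFunctional (u i) P) = 0 := by
    have h1 := h.momentFunctional_derivative (P * P)
    rw [derivative_mul, map_add, mul_comm (derivative P),
      momentFunctional_orthoPoly_mul hm degree_derivative_orthoPoly_lt, add_zero] at h1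
    rw [← neg_eq_zero, h1]
    exact congrArg _ <| Finset.sum_congr rfl fun i _ => by
      rw [momentFunctional_mul_orthoPoly hm (h.shift i) degree_orthoPoly_le]
  have hks : ∑ i, g i * (k.eval (c i) * momentFunctional (u i) k) = 0 := by
    have h1 := h.momentFunctional_derivative (k * k)
    rw [derivative_mul, map_add, mul_comm (derivative k),
      momentFunctional_leadPoly_mul hm (degree_derivative_lt_of_degree_lt hkd),
      coeff_derivative_of_degree_lt hn hkd, add_zero] at h1
    rw [← neg_eq_zero, h1]
    exact congrArg _ <| Finset.sum_congr rfl fun i _ => by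
      rw [momentFunctional_mul_leadPoly hn hm (h.shift i) hkd]
  have hPs : ∑ i, g i * (P.eval (c i) * momentFunctional (u i) k) = -n - ∑ i, g i := by
    rw [← hkP, ← Finset.sum_sub_distrib]
    refine Finset.sum_congr rfl fun i _ => ?_
    have h1 := h.pearsonKernel_eq hn hm i i
    rw [pearsonKernel_self, ← momentFunctional_mul_orthoPoly hm (h.shift i) hkd.le] at h1
    rw [← hk, ← hP] at h1
    linear_combination g i * h1
  have expand : ∀ i j, g i * g j * (pearsonKernel n c m u i j * pearsonKernel n c m u j i)
      = g i * (k.eval (c i) * momentFunctional (u i) P)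
            * (g j * (k.eval (c j) * momentFunctional (u j) P))
        - g i * (k.eval (c i) * momentFunctional (u i) k)
            * (g j * (P.eval (c j) * momentFunctional (u j) P))
        - g i * (P.eval (c i) * momentFunctional (u i) P)
            * (g j * (k.eval (c j) * momentFunctional (u j) k))
        + g i * (P.eval (c i) * momentFunctional (u i) k)
            * (g j * (P.eval (c j) * momentFunctional (u j) k)) := by
    intro i j
    rw [h.pearsonKernel_eq hn hm, h.pearsonKernel_eq hn hm]
    ring
  simp only [expand, Finset.sum_add_distrib, Finset.sum_sub_distrib, ← Finset.sum_mul_sum,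
    hkq, hPq, hks, hPs]
  ring

/-- The diagonal value of the representing polynomial through the kernel. -/
lemma IsPearson.eval_rieszPoly_self (h : IsPearson c g m u) (hc : Function.Injective c)
    (hn : 0 < n) (hm : (hankelMatrix n m).det ≠ 0) (j : ι) :
    (rieszPoly n m (u j)).eval (c j)
      = ∑ i, g i * ((1 - pearsonKernel n c m u j i * pearsonKernel n c m u i j) / (c j - c i)) := by
  have h1 := congrArg (fun p => (derivative p).eval (c j))
    (one_sub_X_sub_C_mul_rieszPoly hn hm (h.shift j))
  simp only [derivative_sub, derivative_mul, derivative_one, derivative_X, derivative_C, eval_sub,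
    eval_add, eval_mul, eval_X, eval_C, sub_self, zero_mul, sub_zero,
    zero_add, one_mul, add_zero, zero_sub, h.derivative_orthoPoly hm,
    h.derivative_leadPoly hn hm, eval_neg, eval_finsetSum, mul_neg, Finset.mul_sum] at h1
  rw [sub_neg_eq_add, neg_add_eq_sub, ← Finset.sum_sub_distrib] at h1
  rw [← neg_inj, h1, ← Finset.sum_neg_distrib]
  refine Finset.sum_congr rfl fun i _ => ?_
  rcases eq_or_ne i j with rfl | hij
  · simp only [sub_self, div_zero, mul_zero, neg_zero]
    ring
  have hne : c j - c i ≠ 0 := sub_ne_zero.2 fun e => hij (hc e).symm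
  have h2 := congrArg (eval (c j)) (C_sub_X_mul_reproPoly hn hm (c i))
  simp only [eval_sub, eval_mul, eval_X, eval_C] at h2
  have h3 : (reproPoly n m (c i)).eval (c j)
      = -((orthoPoly n m).eval (c i) * (leadPoly n m).eval (c j)
        - (leadPoly n m).eval (c i) * (orthoPoly n m).eval (c j)) / (c j - c i) := by
    rw [eq_div_iff hne]
    linear_combination -h2
  have hii := pearsonKernel_self (n := n) (c := c) (m := m) (u := u) i
  have hjj := pearsonKernel_self (n := n) (c := c) (m := m) (u := u) j
  have h4 : 1 - pearsonKernel n c m u j i * pearsonKernel n c m u i j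
      = pearsonKernel n c m u i i * pearsonKernel n c m u j j
        - pearsonKernel n c m u j i * pearsonKernel n c m u i j := by rw [hii, hjj, one_mul]
  rw [h3, h4]
  simp only [h.pearsonKernel_eq hn hm]
  field_simp
  ring

end Pearson

section MatrixDerivative

open Polynomial

/-- Jacobi's formula for the derivative of a determinant. -/
lemma hasDerivAt_det {n : ℕ} {M : ℝ → Matrix (Fin n) (Fin n) ℝ} {M' : Matrix (Fin n) (Fin n) ℝ}
    {t : ℝ} (h : ∀ i j, HasDerivAt (fun s => M s i j) (M' i j) t) :
    HasDerivAt (fun s => (M s).det) ((M t).adjugate * M').trace t := by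
  have h1 : HasDerivAt (fun s => (M s).det)
      (∑ σ : Equiv.Perm (Fin n), ((Equiv.Perm.sign σ : ℤ) : ℝ) *
        ∑ i, (∏ j ∈ Finset.univ.erase i, M t (σ j) j) * M' (σ i) i) t := by
    simp only [Matrix.det_apply']
    refine HasDerivAt.fun_sum fun σ _ => HasDerivAt.const_mul _ ?_
    simpa using HasDerivAt.fun_finsetProd (u := Finset.univ) (f := fun j s => M s (σ j) j)
      (f' := fun j => M' (σ j) j) (x := t) fun i _ => h (σ i) i
  convert h1 using 1
  simp only [Finset.mul_sum]
  rw [Finset.sum_comm, Matrix.trace]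
  refine Finset.sum_congr rfl fun i _ => ?_
  have h2 : ((M t).adjugate * M').diag i = (M t).cramer (fun k => M' k i) i := by
    rw [Matrix.cramer_eq_adjugate_mulVec]
    rfl
  rw [h2, Matrix.cramer_apply, Matrix.det_apply']
  refine Finset.sum_congr rfl fun σ _ => congrArg _ ?_
  rw [← Finset.mul_prod_erase _ _ (Finset.mem_univ i), mul_comm]
  refine congrArg₂ _ (Finset.prod_congr rfl fun j hj => ?_) (by simp)
  rw [Matrix.updateCol_ne (Finset.ne_of_mem_erase hj)]

lemma differentiableAt_inv_apply {n : ℕ} {M : ℝ → Matrix (Fin n) (Fin n) ℝ}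
    {M' : Matrix (Fin n) (Fin n) ℝ} {t : ℝ} (h : ∀ i j, HasDerivAt (fun s => M s i j) (M' i j) t)
    (hdet : (M t).det ≠ 0) (i j : Fin n) : DifferentiableAt ℝ (fun s => (M s)⁻¹ i j) t := by
  simp only [Matrix.inv_def, Ring.inverse_eq_inv', Matrix.smul_apply, smul_eq_mul]
  refine ((hasDerivAt_det h).differentiableAt.inv hdet).mul ?_
  simp only [Matrix.adjugate_apply]
  refine (hasDerivAt_det (M' := M'.updateRow j 0) fun k l => ?_).differentiableAt
  rcases eq_or_ne k j with rfl | hk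
  · simpa using hasDerivAt_const t _
  · simpa [Matrix.updateRow_ne hk] using h k l

lemma moment_add_eq {m u : ℕ → ℝ} {a : ℝ} (hu : ∀ k, u (k + 1) = a * u k + m k) (i j : ℕ) :
    u (i + j) = u i * a ^ j + ∑ l ∈ Finset.range j, m (i + l) * a ^ (j - 1 - l) := by
  induction j with
  | zero => simp
  | succ j ih =>
    rw [← add_assoc, hu, ih, Finset.sum_range_succ, mul_add, Finset.mul_sum]
    have : ∑ l ∈ Finset.range j, a * (m (i + l) * a ^ (j - 1 - l))
        = ∑ l ∈ Finset.range j, m (i + l) * a ^ (j + 1 - 1 - l) := by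
      refine Finset.sum_congr rfl fun l hl => ?_
      have : j + 1 - 1 - l = (j - 1 - l) + 1 := by have := Finset.mem_range.1 hl; omega
      rw [this, pow_succ]
      ring
    rw [this]
    simp
    ring

/-- The trace of `M⁻¹ M_u`, where `M_u` is the Hankel matrix of a functional with
`(x - a) u = m`. -/
lemma trace_inv_mul_hankelMatrix {n : ℕ} {m u : ℕ → ℝ} {a : ℝ}
    (hm : (hankelMatrix n m).det ≠ 0) (hu : ∀ k, u (k + 1) = a * u k + m k) :
    ((hankelMatrix n m)⁻¹ * hankelMatrix n u).trace = (rieszPoly n m u).eval a := by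
  set T : Matrix (Fin n) (Fin n) ℝ :=
    Matrix.of fun l j => if l < j then a ^ ((j : ℕ) - 1 - l) else 0 with hT
  have h1 : hankelMatrix n u
      = hankelMatrix n m * T + Matrix.vecMulVec (fun i : Fin n => u i) (fun j : Fin n => a ^ (j : ℕ)) := by
    ext i j
    rw [hankelMatrix_apply, moment_add_eq hu, Matrix.add_apply, Matrix.mul_apply,
      Matrix.vecMulVec_apply, add_comm]
    congr 1
    simp only [hT, hankelMatrix_apply, Matrix.of_apply, mul_ite, mul_zero, Fin.lt_def]
    rw [Fin.sum_univ_eq_sum_range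
      (fun l => if l < (j : ℕ) then m (i + l) * a ^ ((j : ℕ) - 1 - l) else 0),
      ← Finset.sum_filter]
    refine Finset.sum_congr ?_ fun _ _ => rfl
    ext l
    have := j.2
    simp
    omega
  rw [h1, mul_add, ← mul_assoc, Matrix.nonsing_inv_mul _ (isUnit_iff_ne_zero.2 hm), one_mul,
    Matrix.trace_add, Matrix.mul_vecMulVec, Matrix.trace_vecMulVec, rieszPoly, eval_ofCoeffs]
  simp [Matrix.trace, hT, dotProduct]

lemma eval_derivative_ofCoeffs {n : ℕ} (v : Fin n → ℝ) (x : ℝ) :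
    (derivative (ofCoeffs v)).eval x = ∑ i : Fin n, v i * ((i : ℕ) * x ^ ((i : ℕ) - 1)) := by
  simp only [ofCoeffs, map_sum, derivative_monomial, eval_finsetSum, eval_monomial, mul_assoc]

lemma hasDerivAt_eval_rieszPoly {n : ℕ} {m l : ℝ → ℕ → ℝ} {m' l' : ℕ → ℝ} {ξ : ℝ → ℝ} {ξ' t : ℝ}
    (hm : ∀ k, HasDerivAt (fun s => m s k) (m' k) t)
    (hl : ∀ k, HasDerivAt (fun s => l s k) (l' k) t) (hξ : HasDerivAt ξ ξ' t)
    (hdet : (hankelMatrix n (m t)).det ≠ 0) :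
    HasDerivAt (fun s => (rieszPoly n (m s) (l s)).eval (ξ s))
      (ξ' * (derivative (rieszPoly n (m t) (l t))).eval (ξ t)
        + momentFunctional l' (reproPoly n (m t) (ξ t))
        - momentFunctional m' (reproPoly n (m t) (ξ t) * rieszPoly n (m t) (l t))) t := by
  have hM : ∀ i j, HasDerivAt (fun s => hankelMatrix n (m s) i j) (hankelMatrix n m' i j) t :=
    fun i j => hm _
  set φ : ℝ → Fin n → ℝ :=
    fun s => (hankelMatrix n (m s))⁻¹.mulVec fun i : Fin n => l s i with hφ
  have hφd : ∀ i, ∃ d, HasDerivAt (fun s => φ s i) d t := by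
    intro i
    refine ⟨_, DifferentiableAt.hasDerivAt ?_⟩
    simp only [hφ, Matrix.mulVec, dotProduct]
    exact DifferentiableAt.fun_sum fun j _ =>
      (differentiableAt_inv_apply hM hdet i j).mul (hl j).differentiableAt
  choose φ' hφ' using hφd
  have hev : ∀ᶠ s in nhds t, (hankelMatrix n (m s)).det ≠ 0 :=
    (hasDerivAt_det hM).continuousAt.eventually_ne hdet
  have hsolve : (hankelMatrix n (m t)).mulVec φ'
      = (fun i : Fin n => l' i) - (hankelMatrix n m').mulVec (φ t) := by
    ext i
    have h1 : HasDerivAt (fun s => ∑ j, hankelMatrix n (m s) i j * φ s j)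
        (∑ j, (hankelMatrix n m' i j * φ t j + hankelMatrix n (m t) i j * φ' j)) t :=
      HasDerivAt.fun_sum fun j _ => (hM i j).mul (hφ' j)
    have h2 : (fun s => ∑ j, hankelMatrix n (m s) i j * φ s j) =ᶠ[nhds t] fun s => l s i := by
      filter_upwards [hev] with s hs
      change (hankelMatrix n (m s)).mulVec (φ s) i = l s i
      rw [hφ]
      simp only [Matrix.mulVec_mulVec, Matrix.mul_nonsing_inv _ (isUnit_iff_ne_zero.2 hs),
        Matrix.one_mulVec]
    have h3 := h1.unique ((hl i).congr_of_eventuallyEq h2)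
    rw [Finset.sum_add_distrib] at h3
    simp only [Pi.sub_apply, Matrix.mulVec, dotProduct]
    linarith
  have h4 : HasDerivAt (fun s => ∑ i : Fin n, φ s i * ξ s ^ (i : ℕ))
      (∑ i : Fin n, (φ' i * ξ t ^ (i : ℕ)
        + φ t i * ((i : ℕ) * ξ t ^ ((i : ℕ) - 1) * ξ'))) t :=
    HasDerivAt.fun_sum fun i _ => (hφ' i).mul (hξ.fun_pow i)
  have h5 : ∑ i : Fin n, φ' i * ξ t ^ (i : ℕ)
      = momentFunctional l' (reproPoly n (m t) (ξ t))
        - momentFunctional m' (reproPoly n (m t) (ξ t) * rieszPoly n (m t) (l t)) := by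
    rw [reproPoly, rieszPoly, rieszPoly, momentFunctional_ofCoeffs,
      momentFunctional_ofCoeffs_mul, ← dotProduct_sub]
    change _ = _ ⬝ᵥ ((fun i : Fin n => l' i) - (hankelMatrix n m').mulVec (φ t))
    rw [← hsolve, Matrix.dotProduct_mulVec, ← Matrix.mulVec_transpose, hankelMatrix_transpose,
      Matrix.mulVec_mulVec, Matrix.mul_nonsing_inv _ (isUnit_iff_ne_zero.2 hdet),
      Matrix.one_mulVec]
    simp [dotProduct, mul_comm]
  simp only [rieszPoly, eval_ofCoeffs]
  convert h4 using 1
  rw [Finset.sum_add_distrib, h5, eval_derivative_ofCoeffs, Finset.mul_sum]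
  change _ = _ + ∑ i : Fin n, φ t i * ((i : ℕ) * ξ t ^ ((i : ℕ) - 1) * ξ')
  rw [add_sub_assoc, add_comm]
  refine congrArg₂ _ rfl (Finset.sum_congr rfl fun i _ => ?_)
  ring

end MatrixDerivative

section KernelDerivative

open Polynomial

lemma momentFunctional_natCast_mul (u : ℕ → ℝ) (f : ℝ[X]) :
    momentFunctional (fun k => k * u k) f = momentFunctional u (X * derivative f) := by
  induction f using Polynomial.induction_on' with
  | add p q hp hq => simp only [map_add, mul_add, hp, hq]
  | monomial k b =>
    rcases k with _ | k
    · rw [momentFunctional_monomial]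
      simp
    · simp [X_mul_monomial]
      ring

lemma momentFunctional_add_mul (a b : ℝ) (u v : ℕ → ℝ) (f : ℝ[X]) :
    momentFunctional (fun k => a * u k + b * v k) f
      = a * momentFunctional u f + b * momentFunctional v f := by
  induction f using Polynomial.induction_on' with
  | add p q hp hq => simp only [map_add, hp, hq]; ring
  | monomial k c => simp; ring

lemma momentFunctional_const_mul (a : ℝ) (u : ℕ → ℝ) (f : ℝ[X]) :
    momentFunctional (fun k => a * u k) f = a * momentFunctional u f := by
  simpa using momentFunctional_add_mul a 0 u u f

variable {n : ℕ} {m : ℕ → ℝ}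

lemma momentFunctional_reproPoly (hm : (hankelMatrix n m).det ≠ 0) (v : ℕ → ℝ) (x : ℝ) :
    momentFunctional v (reproPoly n m x) = (rieszPoly n m v).eval x := by
  rw [← momentFunctional_reproPoly_mul hm x (degree_rieszPoly_lt n m v), mul_comm,
    momentFunctional_rieszPoly_mul v hm (show (reproPoly n m x).degree < n from
      degree_rieszPoly_lt n m _)]

lemma momentFunctional_reproPoly_mul_rieszPoly (hm : (hankelMatrix n m).det ≠ 0) {u : ℕ → ℝ}
    {a : ℝ} (hu : ∀ k, u (k + 1) = a * u k + m k) (v : ℕ → ℝ) {x : ℝ} (hx : x - a ≠ 0) :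
    momentFunctional u (reproPoly n m x * rieszPoly n m v)
      = (rieszPoly n m v).eval a * (rieszPoly n m u).eval x
        + ((rieszPoly n m v).eval x - (rieszPoly n m v).eval a) / (x - a) := by
  rw [mul_comm, momentFunctional_mul_split hu, momentFunctional_reproPoly hm, mul_comm (_ /ₘ _),
    momentFunctional_reproPoly_mul hm x
      (degree_divByMonic_X_sub_C_lt a (degree_rieszPoly_lt n m v).le)]
  congr 1
  rw [eq_div_iff hx]
  conv_rhs => rw [sub_C_eval_eq_mul_divByMonic (rieszPoly n m v) a]
  simp
  ring

end KernelDerivative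

section JacobiFlow

open Polynomial

/-- The differential system in `t` satisfied by the moments `m` of the weight
`(x - t)^γ x^α (1 - x)^β` and by the moments `u` of its quotients by `x`, `x - 1`, `x - t`. -/
structure IsJacobiFlow (α β γ : ℝ) (m : ℝ → ℕ → ℝ) (u : ℝ → Fin 3 → ℕ → ℝ) (t : ℝ) : Prop where
  isPearson : IsPearson ![0, 1, t] ![α, β, γ] (m t) (u t)
  hasDerivAt_moment : ∀ k, HasDerivAt (fun s => m s k) (-γ * u t 2 k) t
  hasDerivAt_zero : ∀ k, HasDerivAt (fun s => u s 0 k) (γ / t * (u t 0 k - u t 2 k)) t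
  hasDerivAt_one : ∀ k, HasDerivAt (fun s => u s 1 k) (γ / (t - 1) * (u t 1 k - u t 2 k)) t
  hasDerivAt_two : ∀ k, HasDerivAt (fun s => u s 2 k)
    (((k + (α + β + γ)) * u t 2 k + β / (1 - t) * (u t 1 k - u t 2 k)) / t) t

variable {α β γ t : ℝ} {m : ℝ → ℕ → ℝ} {u : ℝ → Fin 3 → ℕ → ℝ} {n : ℕ}

lemma momentFunctional_mul_sub (a : ℝ) (v w : ℕ → ℝ) (f : ℝ[X]) :
    momentFunctional (fun k => a * (v k - w k)) f
      = a * (momentFunctional v f - momentFunctional w f) := by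
  have := momentFunctional_add_mul a (-a) v w f
  simp only [neg_mul, ← sub_eq_add_neg, ← mul_sub] at this
  exact this

lemma degree_X_mul_derivative_lt {f : ℝ[X]} (hf : f.degree < n) :
    (X * derivative f).degree < (n : WithBot ℕ) := by
  rw [degree_lt_iff_coeff_zero] at hf ⊢
  intro k hk
  rcases k with _ | k
  · simp
  · rw [coeff_X_mul, coeff_derivative, hf _ hk, zero_mul]

/-- The shift relations of the three quotient moments. -/
lemma IsJacobiFlow.shift (h : IsJacobiFlow α β γ m u t) :
    (∀ k, u t 0 (k + 1) = 0 * u t 0 k + m t k) ∧ (∀ k, u t 1 (k + 1) = 1 * u t 1 k + m t k) ∧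
      ∀ k, u t 2 (k + 1) = t * u t 2 k + m t k :=
  ⟨h.isPearson.shift 0, h.isPearson.shift 1, h.isPearson.shift 2⟩

lemma IsJacobiFlow.momentFunctional_derivative_X_mul (h : IsJacobiFlow α β γ m u t) (f : ℝ[X]) :
    momentFunctional (m t) (derivative (X * f))
      = -((α + β + γ) * momentFunctional (m t) f + β * momentFunctional (u t 1) f
          + γ * t * momentFunctional (u t 2) f) := by
  have e : ∀ a : ℝ, X * f = (X - C a) * f + C a * f := fun a => by ring
  rw [h.isPearson.momentFunctional_derivative, Fin.sum_univ_three]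
  obtain ⟨h0, h1, h2⟩ := h.shift
  have e0 := congrArg (momentFunctional (u t 0)) (e 0)
  have e1 := congrArg (momentFunctional (u t 1)) (e 1)
  have e2 := congrArg (momentFunctional (u t 2)) (e t)
  rw [map_add, momentFunctional_X_sub_C_mul h0, momentFunctional_C_mul] at e0
  rw [map_add, momentFunctional_X_sub_C_mul h1, momentFunctional_C_mul] at e1
  rw [map_add, momentFunctional_X_sub_C_mul h2, momentFunctional_C_mul] at e2
  rw [e0, e1, e2]
  simp only [Matrix.cons_val]
  ring

/-- Derivative of a representing polynomial for a functional which is homogeneous up to a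
perturbation at the node `1`. -/
lemma IsJacobiFlow.hasDerivAt_eval_of_scaling (h : IsJacobiFlow α β γ m u t)
    (hdet : (hankelMatrix n (m t)).det ≠ 0) (ht : t ≠ 0) {l : ℝ → ℕ → ℝ} {r : ℝ} {ξ : ℝ → ℝ}
    {ξ' : ℝ} (hξ : HasDerivAt ξ ξ' t) (hξt : t * ξ' = ξ t)
    (hl : ∀ k, HasDerivAt (fun s => l s k)
      (((k + (α + β + γ)) * l t k + r * (u t 1 k - l t k)) / t) t) :
    HasDerivAt (fun s => (rieszPoly n (m s) (l s)).eval (ξ s))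
      ((-(rieszPoly n (m t) (l t)).eval (ξ t)
        + r * ((rieszPoly n (m t) (u t 1)).eval (ξ t) - (rieszPoly n (m t) (l t)).eval (ξ t))
        - β * momentFunctional (u t 1)
          (reproPoly n (m t) (ξ t) * rieszPoly n (m t) (l t))) / t) t := by
  have hd := hasDerivAt_eval_rieszPoly h.hasDerivAt_moment hl hξ hdet
  convert hd using 1
  set A := reproPoly n (m t) (ξ t) with hA
  set Φ := rieszPoly n (m t) (l t) with hΦ
  have hAd : A.degree < n := degree_rieszPoly_lt _ _ _
  have hΦd : Φ.degree < n := degree_rieszPoly_lt _ _ _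
  have e1 : momentFunctional
      (fun k => ((k + (α + β + γ)) * l t k + r * (u t 1 k - l t k)) / t) A
      = (momentFunctional (l t) (X * derivative A) + (α + β + γ) * Φ.eval (ξ t)
        + r * ((rieszPoly n (m t) (u t 1)).eval (ξ t) - Φ.eval (ξ t))) / t := by
    have : (fun k : ℕ => ((k + (α + β + γ)) * l t k + r * (u t 1 k - l t k)) / t)
        = fun k => t⁻¹ * (1 * (1 * (k * l t k) + (α + β + γ) * l t k)
          + r * (1 * u t 1 k + (-1) * l t k)) := by
      funext k; rw [div_eq_inv_mul]; ring
    rw [this, momentFunctional_const_mul, momentFunctional_add_mul, momentFunctional_add_mul,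
      momentFunctional_add_mul, momentFunctional_natCast_mul, hA, momentFunctional_reproPoly hdet,
      momentFunctional_reproPoly hdet, ← hA, ← hΦ]
    ring
  have e2 := h.momentFunctional_derivative_X_mul (A * Φ)
  have e3 : derivative (X * (A * Φ))
      = A * Φ + Φ * (X * derivative A) + A * (X * derivative Φ) := by
    simp only [derivative_mul, derivative_X]; ring
  rw [e3, map_add, map_add, momentFunctional_rieszPoly_mul _ hdet (degree_X_mul_derivative_lt hAd),
    momentFunctional_reproPoly_mul hdet _ hΦd,
    momentFunctional_reproPoly_mul hdet _ (degree_X_mul_derivative_lt hΦd), eval_mul, eval_X] at e2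
  rw [e1, momentFunctional_const_mul, div_eq_iff ht]
  field_simp
  linear_combination (-1) * e2 - (derivative Φ).eval (ξ t) * hξt

/-- Derivative at a fixed node of a representing polynomial. -/
lemma IsJacobiFlow.hasDerivAt_eval_of_fixed (h : IsJacobiFlow α β γ m u t)
    (hdet : (hankelMatrix n (m t)).det ≠ 0) {x r : ℝ} (hx : x - t ≠ 0) {l : ℝ → ℕ → ℝ}
    (hl : ∀ k, HasDerivAt (fun s => l s k) (r * (l t k - u t 2 k)) t) :
    HasDerivAt (fun s => (rieszPoly n (m s) (l s)).eval x)
      (r * ((rieszPoly n (m t) (l t)).eval x - (rieszPoly n (m t) (u t 2)).eval x)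
        + γ * ((rieszPoly n (m t) (l t)).eval t * (rieszPoly n (m t) (u t 2)).eval x
          + ((rieszPoly n (m t) (l t)).eval x - (rieszPoly n (m t) (l t)).eval t) / (x - t))) t := by
  have hd := hasDerivAt_eval_rieszPoly h.hasDerivAt_moment hl (hasDerivAt_const t x) hdet
  convert hd using 1
  rw [momentFunctional_mul_sub, momentFunctional_const_mul,
    momentFunctional_reproPoly_mul_rieszPoly hdet h.shift.2.2 _ hx,
    momentFunctional_reproPoly hdet, momentFunctional_reproPoly hdet]
  ring

/-- Evolution of the product of kernels between the fixed nodes. -/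
lemma IsJacobiFlow.hasDerivAt_pearsonKernel_zero_one (h : IsJacobiFlow α β γ m u t)
    (hdet : (hankelMatrix n (m t)).det ≠ 0) (ht : t ≠ 0) (ht1 : t - 1 ≠ 0) :
    HasDerivAt (fun s => pearsonKernel n ![0, 1, s] (m s) (u s) 0 1
        * pearsonKernel n ![0, 1, s] (m s) (u s) 1 0)
      (γ / (t * (t - 1)) *
        (pearsonKernel n ![0, 1, t] (m t) (u t) 0 1 * pearsonKernel n ![0, 1, t] (m t) (u t) 1 2
            * pearsonKernel n ![0, 1, t] (m t) (u t) 2 0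
          - pearsonKernel n ![0, 1, t] (m t) (u t) 0 2 * pearsonKernel n ![0, 1, t] (m t) (u t) 2 1
            * pearsonKernel n ![0, 1, t] (m t) (u t) 1 0)) t := by
  have ht1' : 1 - t ≠ 0 := by rwa [← neg_sub, neg_ne_zero]
  have h01 := h.hasDerivAt_eval_of_fixed (n := n) hdet (x := 0) (by simpa using ht) h.hasDerivAt_one
  have h10 := h.hasDerivAt_eval_of_fixed (n := n) hdet (x := 1) ht1' h.hasDerivAt_zero
  have := ((h01.const_mul (0 - 1)).const_sub 1).fun_mul ((h10.const_mul (1 - 0)).const_sub 1)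
  simp only [pearsonKernel, Matrix.cons_val]
  refine this.congr_deriv ?_
  have e : 1 - t = -(t - 1) := by ring
  rw [e]
  field_simp
  ring

/-- Evolution of the product of kernels between the node `0` and the moving node. -/
lemma IsJacobiFlow.hasDerivAt_pearsonKernel_zero_two (h : IsJacobiFlow α β γ m u t)
    (hdet : (hankelMatrix n (m t)).det ≠ 0) (ht : t ≠ 0) (ht1 : t - 1 ≠ 0) :
    HasDerivAt (fun s => pearsonKernel n ![0, 1, s] (m s) (u s) 0 2
        * pearsonKernel n ![0, 1, s] (m s) (u s) 2 0)
      (-β / (t - 1) *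
        (pearsonKernel n ![0, 1, t] (m t) (u t) 0 1 * pearsonKernel n ![0, 1, t] (m t) (u t) 1 2
            * pearsonKernel n ![0, 1, t] (m t) (u t) 2 0
          - pearsonKernel n ![0, 1, t] (m t) (u t) 0 2 * pearsonKernel n ![0, 1, t] (m t) (u t) 2 1
            * pearsonKernel n ![0, 1, t] (m t) (u t) 1 0)) t := by
  have ht1' : 1 - t ≠ 0 := by rwa [← neg_sub, neg_ne_zero]
  have hzero : ∀ k : ℕ, HasDerivAt (fun s => u s 0 k)
      (((k + (α + β + γ)) * u t 0 k + β * (u t 1 k - u t 0 k)) / t) t := by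
    intro k
    convert h.hasDerivAt_zero k using 1
    have hp := h.isPearson.pearson k
    rw [Fin.sum_univ_three] at hp
    simp only [Matrix.cons_val] at hp
    have hk : (k : ℝ) * u t 0 k = k * m t (k - 1) := by
      rcases k with _ | k
      · simp
      · rw [h.shift.1 k]; simp
    rw [div_mul_eq_mul_div]
    congr 1
    linear_combination hk + hp
  have h02 := h.hasDerivAt_eval_of_scaling (n := n) hdet ht (hasDerivAt_const t 0) (by simp)
    h.hasDerivAt_two
  have h20 := h.hasDerivAt_eval_of_scaling (n := n) hdet ht (hasDerivAt_id t) (by simp) hzero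
  simp only [id] at h20
  have := ((((hasDerivAt_id t).const_sub 0).fun_mul h02).const_sub 1).fun_mul
    ((((hasDerivAt_id t).sub_const 0).fun_mul h20).const_sub 1)
  simp only [pearsonKernel, Matrix.cons_val]
  refine this.congr_deriv ?_
  rw [momentFunctional_reproPoly_mul_rieszPoly hdet h.shift.2.1 _ (by simp),
    momentFunctional_reproPoly_mul_rieszPoly hdet h.shift.2.1 _ ht1]
  have e : 1 - t = -(t - 1) := by ring
  simp only [id, e]
  field_simp
  ring

end JacobiFlow

section SigmaForm

variable {α β γ t : ℝ} {m : ℝ → ℕ → ℝ} {u : ℝ → Fin 3 → ℕ → ℝ} {n : ℕ}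

lemma IsJacobiFlow.hasDerivAt_log_det (h : IsJacobiFlow α β γ m u t)
    (hdet : (hankelMatrix n (m t)).det ≠ 0) :
    HasDerivAt (fun s => Real.log (hankelMatrix n (m s)).det)
      (-γ * (rieszPoly n (m t) (u t 2)).eval t) t := by
  have hM : ∀ i j, HasDerivAt (fun s => hankelMatrix n (m s) i j)
      ((-γ • hankelMatrix n (u t 2)) i j) t := fun i j => h.hasDerivAt_moment _
  refine ((hasDerivAt_det hM).log hdet).congr_deriv ?_
  rw [← trace_inv_mul_hankelMatrix hdet h.shift.2.2, Matrix.inv_def, Ring.inverse_eq_inv',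
    Matrix.smul_mul, Matrix.trace_smul, Matrix.mul_smul, Matrix.trace_smul, smul_eq_mul,
    smul_eq_mul, div_eq_inv_mul]
  ring

/-- The kernel products satisfy a quadratic relation coming from the Pearson equation. -/
lemma IsJacobiFlow.sum_pearsonKernel (h : IsJacobiFlow α β γ m u t) (hn : 0 < n)
    (hdet : (hankelMatrix n (m t)).det ≠ 0) :
    α * β * (pearsonKernel n ![0, 1, t] (m t) (u t) 0 1
        * pearsonKernel n ![0, 1, t] (m t) (u t) 1 0)
      + α * γ * (pearsonKernel n ![0, 1, t] (m t) (u t) 0 2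
        * pearsonKernel n ![0, 1, t] (m t) (u t) 2 0)
      + β * γ * (pearsonKernel n ![0, 1, t] (m t) (u t) 1 2
        * pearsonKernel n ![0, 1, t] (m t) (u t) 2 1)
      = n * (n + α + β + γ) + α * β + α * γ + β * γ := by
  have := h.isPearson.sum_pearsonKernel_mul hn hdet
  simp only [Fin.sum_univ_three, pearsonKernel_self] at this
  simp only [Matrix.cons_val] at this
  linear_combination this / 2

/-- The logarithmic derivative of the Hankel determinant in terms of kernel products. -/
lemma IsJacobiFlow.mul_deriv_log_det (h : IsJacobiFlow α β γ m u t) (hn : 0 < n)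
    (hdet : (hankelMatrix n (m t)).det ≠ 0) (ht : t ≠ 0) (ht1 : t ≠ 1) :
    t * (t - 1) * deriv (fun s => Real.log (hankelMatrix n (m s)).det) t
      = -(α * γ * (pearsonKernel n ![0, 1, t] (m t) (u t) 0 2
            * pearsonKernel n ![0, 1, t] (m t) (u t) 2 0))
        - t * (α * β * (pearsonKernel n ![0, 1, t] (m t) (u t) 0 1
            * pearsonKernel n ![0, 1, t] (m t) (u t) 1 0))
        + t * (n * (n + α + β + γ) + α * β) + γ * α := by
  have hc : Function.Injective ![0, 1, t] := by
    intro i j hij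
    fin_cases i <;> fin_cases j <;> simp_all [eq_comm]
  have e := h.isPearson.eval_rieszPoly_self hc hn hdet 2
  have ht1' : t - 1 ≠ 0 := sub_ne_zero.2 ht1
  simp only [Fin.sum_univ_three, pearsonKernel_self] at e
  simp only [Matrix.cons_val] at e
  rw [(h.hasDerivAt_log_det hdet).deriv, e]
  have hs := h.sum_pearsonKernel hn hdet
  field_simp
  linear_combination t ^ 2 * hs

/-- The algebraic identity behind the Jimbo–Miwa–Okamoto form, in terms of the
kernel products `a`, `b`, `c`, `X`, `Y`. -/
lemma sigmaForm_of_kernel_relations {N a b c X Y H H₁ H₂ : ℝ} (hadd : X + Y = a + b + c - 1)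
    (hmul : X * Y = a * b * c)
    (hS : α * β * a + α * γ * b + β * γ * c = N * (N + α + β + γ) + α * β + α * γ + β * γ)
    (hH : H = -(α * γ * b) - t * (α * β * a) + t * (N * (N + α + β + γ) + α * β) + γ * α
      + (-(N * (N + α + β + γ)) - (α + β) ^ 2 / 4) * t
      + (2 * N * (N + α + β + γ) + β * (α + β) - γ * (α - β)) / 4)
    (hH₁ : H₁ = -(α * β * a) - (α - β) ^ 2 / 4) (hH₂ : H₂ = -(α * β * γ * (X - Y))) :
    H₁ * H₂ ^ 2
        + (2 * H₁ * (t * H₁ - H) - H₁ ^ 2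
            - ((α + β) / 2) * ((β - α) / 2) * ((2 * N + α + β) / 2)
              * ((2 * N + α + β + 2 * γ) / 2)) ^ 2
      = (H₁ + ((α + β) / 2) ^ 2) * (H₁ + ((β - α) / 2) ^ 2)
          * (H₁ + ((2 * N + α + β) / 2) ^ 2)
          * (H₁ + ((2 * N + α + β + 2 * γ) / 2) ^ 2) := by
  set A := α * β * a with hA
  set B := α * γ * b with hB
  set K := β * γ * c with hK
  have hsq : H₂ ^ 2 = (γ * A + β * B + α * K - α * β * γ) ^ 2 - 4 * A * B * K := by
    have : (X - Y) ^ 2 = (a + b + c - 1) ^ 2 - 4 * (a * b * c) := by rw [← hadd, ← hmul]; ring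
    rw [hH₂, neg_sq, mul_pow, this, hA, hB, hK]
    ring
  have hK' : K = N * (N + α + β + γ) + α * β + α * γ + β * γ - A - B := by linarith
  rw [hsq, hK', hH, hH₁]
  ring

/-- The Jimbo–Miwa–Okamoto form of Painlevé VI for the Hankel determinants of a Jacobi flow. -/
theorem IsJacobiFlow.sigmaForm (h : ∀ t < 0, IsJacobiFlow α β γ m u t) (hn : 0 < n)
    (hdet : ∀ t < 0, (hankelMatrix n (m t)).det ≠ 0) {Ht : ℝ → ℝ}
    (hHt : ∀ t < (0:ℝ),
      Ht t = t * (t - 1) * deriv (fun s => Real.log (hankelMatrix n (m s)).det) t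
        + (-(n * (n + α + β + γ)) - (α + β) ^ 2 / 4) * t
        + (2 * n * (n + α + β + γ) + β * (α + β) - γ * (α - β)) / 4) (ht : t < 0) :
      deriv Ht t * (t * (t - 1) * deriv (deriv Ht) t) ^ 2
        + (2 * deriv Ht t * (t * deriv Ht t - Ht t) - (deriv Ht t) ^ 2
            - ((α + β) / 2) * ((β - α) / 2) * ((2 * n + α + β) / 2)
              * ((2 * n + α + β + 2 * γ) / 2)) ^ 2
      = (deriv Ht t + ((α + β) / 2) ^ 2) * (deriv Ht t + ((β - α) / 2) ^ 2)
          * (deriv Ht t + ((2 * n + α + β) / 2) ^ 2)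
          * (deriv Ht t + ((2 * n + α + β + 2 * γ) / 2) ^ 2) := by
  set a : ℝ → ℝ := fun s => pearsonKernel n ![0, 1, s] (m s) (u s) 0 1
    * pearsonKernel n ![0, 1, s] (m s) (u s) 1 0 with ha
  set b : ℝ → ℝ := fun s => pearsonKernel n ![0, 1, s] (m s) (u s) 0 2
    * pearsonKernel n ![0, 1, s] (m s) (u s) 2 0 with hb
  have hval : ∀ s < 0, Ht s = -(α * γ * b s) - s * (α * β * a s)
      + s * (n * (n + α + β + γ) + α * β) + γ * α
      + (-(n * (n + α + β + γ)) - (α + β) ^ 2 / 4) * s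
      + (2 * n * (n + α + β + γ) + β * (α + β) - γ * (α - β)) / 4 := fun s hs => by
    rw [hHt s hs, (h s hs).mul_deriv_log_det hn (hdet s hs) hs.ne (by linarith)]
  have hev : ∀ s < (0:ℝ), ∀ᶠ r in nhds s, r < 0 := fun s hs => Iio_mem_nhds hs
  have hd1 : ∀ s < 0, deriv Ht s = -(α * β * a s) - (α - β) ^ 2 / 4 := by
    intro s hs
    have hs1 : s - 1 ≠ 0 := by linarith
    have hda := (h s hs).hasDerivAt_pearsonKernel_zero_one (hdet s hs) hs.ne hs1
    have hdb := (h s hs).hasDerivAt_pearsonKernel_zero_two (hdet s hs) hs.ne hs1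
    have hid := hasDerivAt_id s
    have := (((((hdb.const_mul (α * γ)).neg.sub (hid.mul (hda.const_mul (α * β)))).add
      (hid.mul_const (n * (n + α + β + γ) + α * β))).add_const (γ * α)).add
      (hid.const_mul (-(n * (n + α + β + γ)) - (α + β) ^ 2 / 4))).add_const
      ((2 * n * (n + α + β + γ) + β * (α + β) - γ * (α - β)) / 4)
    have := this.congr_of_eventuallyEq (f₁ := Ht) ((hev s hs).mono hval)
    rw [this.deriv]
    have hs0 : s ≠ 0 := hs.ne
    simp only [id, ha]
    field_simp
    ring
  have ht1 : t - 1 ≠ 0 := by linarith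
  have hd2 := ((((h t ht).hasDerivAt_pearsonKernel_zero_one (hdet t ht) ht.ne ht1).const_mul
    (α * β)).neg.sub_const ((α - β) ^ 2 / 4)).congr_of_eventuallyEq (f₁ := deriv Ht)
    ((hev t ht).mono hd1)
  have ht0 : t ≠ 0 := ht.ne
  refine sigmaForm_of_kernel_relations ((h t ht).isPearson.pearsonKernel_det hn (hdet t ht) 0 1 2)
    ?_ ((h t ht).sum_pearsonKernel hn (hdet t ht)) (hval t ht) (hd1 t ht) ?_
  · ring
  · rw [hd2.deriv]
    field_simp

end SigmaForm

section JacobiMoments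

/-- The moments of the generalized Jacobi weight. -/
noncomputable def jacobiMoment (α β γ t : ℝ) (k : ℕ) : ℝ :=
  ∫ x in (0:ℝ)..1, x ^ k * genJacobiWeight α β γ t x

lemma intervalIntegrable_rpow_mul_one_sub_rpow {α β : ℝ} (hα : -1 < α) (hβ : -1 < β) :
    IntervalIntegrable (fun x : ℝ => x ^ α * (1 - x) ^ β) volume 0 1 := by
  have left : ∀ {α β : ℝ}, -1 < α →
      IntervalIntegrable (fun x : ℝ => x ^ α * (1 - x) ^ β) volume 0 (1 / 2) := by
    intro α β hα
    refine (intervalIntegral.intervalIntegrable_rpow' hα).mul_continuousOn ?_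
    refine ContinuousOn.rpow_const (by fun_prop) fun x hx => Or.inl ?_
    rw [Set.uIcc_of_le (by norm_num)] at hx
    linarith [hx.2]
  refine (left hα).trans ?_
  have := (left (β := α) hβ).symm.comp_sub_left 1
  norm_num at this
  refine this.congr fun x _ => ?_
  simp [mul_comm]

lemma continuousOn_sub_rpow {t : ℝ} (ht : t < 0) (γ : ℝ) :
    ContinuousOn (fun x : ℝ => (x - t) ^ γ) (Set.uIcc 0 1) := by
  refine ContinuousOn.rpow_const (by fun_prop) fun x hx => Or.inl ?_
  rw [Set.uIcc_of_le zero_le_one] at hx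
  linarith [hx.1]

lemma intervalIntegrable_pow_mul_genJacobiWeight {α β γ t : ℝ} (hα : -1 < α) (hβ : -1 < β)
    (ht : t < 0) (k : ℕ) :
    IntervalIntegrable (fun x : ℝ => x ^ k * genJacobiWeight α β γ t x) volume 0 1 := by
  refine (((intervalIntegrable_rpow_mul_one_sub_rpow hα hβ).continuousOn_mul
    (continuousOn_sub_rpow ht γ)).continuousOn_mul
    (g := fun x => x ^ k) (by fun_prop)).congr fun x _ => ?_
  simp [genJacobiWeight, mul_assoc]

lemma mul_rpow_sub_one {x a : ℝ} (hx : 0 ≤ x) (ha : a ≠ 0) : x * x ^ (a - 1) = x ^ a := by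
  rcases hx.eq_or_lt with rfl | hx
  · simp [Real.zero_rpow ha]
  · rw [Real.rpow_sub_one hx.ne', mul_div_cancel₀ _ hx.ne']

lemma jacobiMoment_succ_sub_one_left {α : ℝ} (hα : α ≠ 0) (β γ t : ℝ) (k : ℕ) :
    jacobiMoment (α - 1) β γ t (k + 1) = jacobiMoment α β γ t k := by
  refine intervalIntegral.integral_congr fun x hx => ?_
  rw [Set.uIcc_of_le zero_le_one] at hx
  simp only [genJacobiWeight, ← mul_rpow_sub_one hx.1 hα]
  ring

lemma jacobiMoment_succ_sub_one_right {α β γ t : ℝ} (hα : -1 < α) (hβ : 0 < β) (ht : t < 0)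
    (k : ℕ) :
    jacobiMoment α (β - 1) γ t (k + 1)
      = jacobiMoment α (β - 1) γ t k - jacobiMoment α β γ t k := by
  rw [jacobiMoment, jacobiMoment, jacobiMoment, ← intervalIntegral.integral_sub
    (intervalIntegrable_pow_mul_genJacobiWeight hα (by linarith) ht k)
    (intervalIntegrable_pow_mul_genJacobiWeight hα (by linarith) ht k)]
  refine intervalIntegral.integral_congr fun x hx => ?_
  rw [Set.uIcc_of_le zero_le_one] at hx
  simp only [genJacobiWeight, ← mul_rpow_sub_one (sub_nonneg.2 hx.2) hβ.ne']
  ring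

lemma sub_mul_sub_rpow_sub_one {x t : ℝ} (hx : t < x) (γ : ℝ) :
    (x - t) * (x - t) ^ (γ - 1) = (x - t) ^ γ := by
  rw [Real.rpow_sub_one (sub_pos.2 hx).ne', mul_div_cancel₀ _ (sub_pos.2 hx).ne']

lemma jacobiMoment_succ_sub_one_mid {α β γ t : ℝ} (hα : -1 < α) (hβ : -1 < β) (ht : t < 0)
    (k : ℕ) :
    jacobiMoment α β (γ - 1) t (k + 1)
      = t * jacobiMoment α β (γ - 1) t k + jacobiMoment α β γ t k := by
  rw [jacobiMoment, jacobiMoment, jacobiMoment, ← intervalIntegral.integral_const_mul,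
    ← intervalIntegral.integral_add
    ((intervalIntegrable_pow_mul_genJacobiWeight hα hβ ht k).const_mul t)
    (intervalIntegrable_pow_mul_genJacobiWeight hα hβ ht k)]
  refine intervalIntegral.integral_congr fun x hx => ?_
  rw [Set.uIcc_of_le zero_le_one] at hx
  simp only [genJacobiWeight, ← sub_mul_sub_rpow_sub_one (ht.trans_le hx.1) γ]
  ring

lemma continuousOn_genJacobiWeight {α β γ t : ℝ} (hα : 0 < α) (hβ : 0 < β) (ht : t < 0) :
    ContinuousOn (genJacobiWeight α β γ t) (Set.Icc 0 1) := by
  unfold genJacobiWeight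
  refine ((continuousOn_sub_rpow ht γ).mono Set.Icc_subset_uIcc |>.mul ?_).mul ?_
  · exact continuousOn_id.rpow_const fun _ _ => Or.inr hα.le
  · exact ContinuousOn.rpow_const (by fun_prop) fun _ _ => Or.inr hβ.le

/-- Integration by parts for the generalized Jacobi weight. -/
lemma jacobiMoment_pearson {α β γ t : ℝ} (hα : 0 < α) (hβ : 0 < β) (ht : t < 0) (k : ℕ) :
    k * jacobiMoment α β γ t (k - 1) + α * jacobiMoment (α - 1) β γ t k
      - β * jacobiMoment α (β - 1) γ t k + γ * jacobiMoment α β (γ - 1) t k = 0 := by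
  have i1 := (intervalIntegrable_pow_mul_genJacobiWeight (γ := γ) (by linarith : -1 < α)
    (by linarith : -1 < β) ht (k - 1)).const_mul (k : ℝ)
  have i2 := (intervalIntegrable_pow_mul_genJacobiWeight (γ := γ) (by linarith : -1 < α - 1)
    (by linarith : -1 < β) ht k).const_mul α
  have i3 := (intervalIntegrable_pow_mul_genJacobiWeight (γ := γ) (by linarith : -1 < α)
    (by linarith : -1 < β - 1) ht k).const_mul β
  have i4 := (intervalIntegrable_pow_mul_genJacobiWeight (γ := γ - 1) (by linarith : -1 < α)
    (by linarith : -1 < β) ht k).const_mul γ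
  have hd : ∀ x ∈ Set.Ioo (0:ℝ) 1, HasDerivAt (fun x => x ^ k * genJacobiWeight α β γ t x)
      (k * (x ^ (k - 1) * genJacobiWeight α β γ t x) + α * (x ^ k * genJacobiWeight (α - 1) β γ t x)
        - β * (x ^ k * genJacobiWeight α (β - 1) γ t x)
        + γ * (x ^ k * genJacobiWeight α β (γ - 1) t x)) x := by
    intro x hx
    have d1 := ((hasDerivAt_id x).sub_const t).rpow_const (p := γ)
      (Or.inl (by simp only [id]; linarith [hx.1]))
    have d2 := (hasDerivAt_id x).rpow_const (p := α) (Or.inl hx.1.ne')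
    have d3 := ((hasDerivAt_id x).const_sub 1).rpow_const (p := β)
      (Or.inl (by simp only [id]; linarith [hx.2]))
    refine ((hasDerivAt_pow k x).fun_mul ((d1.fun_mul d2).fun_mul d3)).congr_deriv ?_
    simp only [genJacobiWeight, id]
    ring
  have := intervalIntegral.integral_eq_sub_of_hasDerivAt_of_le zero_le_one
    ((continuous_pow k).continuousOn.mul (continuousOn_genJacobiWeight hα hβ ht)) hd
    (((i1.add i2).sub i3).add i4)
  rw [intervalIntegral.integral_add ((i1.add i2).sub i3) i4,
    intervalIntegral.integral_sub (i1.add i2) i3, intervalIntegral.integral_add i1 i2] at this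
  simp only [intervalIntegral.integral_const_mul] at this
  simpa [jacobiMoment, genJacobiWeight, Real.zero_rpow hα.ne', Real.zero_rpow hβ.ne'] using this

lemma rpow_le_rpow_add_rpow {a b z : ℝ} (ha : 0 < a) (haz : a ≤ z) (hzb : z ≤ b) (r : ℝ) :
    z ^ r ≤ a ^ r + b ^ r := by
  rcases le_total 0 r with hr | hr
  · linarith [Real.rpow_le_rpow (ha.le.trans haz) hzb hr, Real.rpow_nonneg ha.le r]
  · linarith [Real.rpow_le_rpow_of_nonpos ha haz hr,
      Real.rpow_nonneg (ha.le.trans (haz.trans hzb)) r]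

lemma hasDerivAt_integral_sub_rpow_mul {g : ℝ → ℝ} (hg : IntervalIntegrable g volume 0 1)
    {t : ℝ} (ht : t < 0) (γ : ℝ) :
    HasDerivAt (fun s => ∫ x in (0:ℝ)..1, (x - s) ^ γ * g x)
      (∫ x in (0:ℝ)..1, -γ * ((x - t) ^ (γ - 1) * g x)) t := by
  refine (intervalIntegral.hasDerivAt_integral_of_dominated_loc_of_deriv_le
    (F := fun s x => (x - s) ^ γ * g x) (F' := fun s x => -γ * ((x - s) ^ (γ - 1) * g x))
    (bound := fun x => |γ| * ((-t / 2) ^ (γ - 1) + (1 - 2 * t) ^ (γ - 1)) * |g x|)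
    (Ioo_mem_nhds (by linarith : 2 * t < t) (by linarith : t < t / 2)) ?_ ?_ ?_ ?_ ?_ ?_).2
  · filter_upwards [Iio_mem_nhds ht] with s hs
    exact (hg.continuousOn_mul (continuousOn_sub_rpow hs γ)).aestronglyMeasurable_restrict_uIoc
  · exact hg.continuousOn_mul (continuousOn_sub_rpow ht γ)
  · exact ((hg.continuousOn_mul (continuousOn_sub_rpow ht (γ - 1))).const_mul
      (-γ)).aestronglyMeasurable_restrict_uIoc
  · refine Filter.Eventually.of_forall fun x hx s hs => ?_
    rw [Set.uIoc_of_le zero_le_one] at hx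
    have hpos : 0 ≤ x - s := by linarith [hx.1, hs.2]
    rw [norm_mul, norm_mul, norm_neg, Real.norm_eq_abs, Real.norm_eq_abs, Real.norm_eq_abs,
      mul_assoc, abs_of_nonneg (Real.rpow_nonneg hpos _)]
    gcongr
    exact rpow_le_rpow_add_rpow (by linarith) (by linarith [hx.1, hs.2])
      (by linarith [hx.2, hs.1]) _
  · exact hg.abs.const_mul _
  · refine Filter.Eventually.of_forall fun x hx s hs => ?_
    rw [Set.uIoc_of_le zero_le_one] at hx
    have := (((hasDerivAt_id s).const_sub x).rpow_const (p := γ)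
      (Or.inl (by simp only [id]; linarith [hx.1, hs.2]))).mul_const (g x)
    refine this.congr_deriv ?_
    simp only [id]
    ring

lemma hasDerivAt_jacobiMoment {α β t : ℝ} (hα : -1 < α) (hβ : -1 < β) (ht : t < 0) (γ : ℝ)
    (k : ℕ) :
    HasDerivAt (fun s => jacobiMoment α β γ s k) (-γ * jacobiMoment α β (γ - 1) t k) t := by
  have hg : IntervalIntegrable (fun x : ℝ => x ^ k * (x ^ α * (1 - x) ^ β)) volume 0 1 :=
    (intervalIntegrable_rpow_mul_one_sub_rpow hα hβ).continuousOn_mul (by fun_prop)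
  have e : ∀ γ s, jacobiMoment α β γ s k
      = ∫ x in (0:ℝ)..1, (x - s) ^ γ * (x ^ k * (x ^ α * (1 - x) ^ β)) := fun γ s => by
    refine intervalIntegral.integral_congr fun x _ => ?_
    simp only [genJacobiWeight]
    ring
  simp only [e]
  rw [← intervalIntegral.integral_const_mul]
  exact hasDerivAt_integral_sub_rpow_mul hg ht γ

lemma momentFunctional_jacobiMoment {α β γ t : ℝ} (hα : -1 < α) (hβ : -1 < β) (ht : t < 0)
    (f : Polynomial ℝ) :
    momentFunctional (jacobiMoment α β γ t) f
      = ∫ x in (0:ℝ)..1, f.eval x * genJacobiWeight α β γ t x := by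
  have hintegral : ∀ p : Polynomial ℝ,
      IntervalIntegrable (fun x => p.eval x * genJacobiWeight α β γ t x) volume 0 1 := fun p => by
    have := intervalIntegrable_pow_mul_genJacobiWeight (γ := γ) hα hβ ht 0
    simp only [pow_zero, one_mul] at this
    exact this.continuousOn_mul p.continuous.continuousOn
  induction f using Polynomial.induction_on' with
  | add p q hp hq =>
    simp only [map_add, hp, hq, Polynomial.eval_add, add_mul]
    rw [intervalIntegral.integral_add (hintegral p) (hintegral q)]
  | monomial k b =>
    simp only [momentFunctional_monomial, jacobiMoment, Polynomial.eval_monomial, mul_assoc,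
      intervalIntegral.integral_const_mul]
    ring

lemma det_hankelMatrix_jacobiMoment_ne_zero {α β γ t : ℝ} (hα : 0 < α) (hβ : 0 < β) (ht : t < 0)
    (n : ℕ) : (hankelMatrix n (jacobiMoment α β γ t)).det ≠ 0 := by
  intro h0
  obtain ⟨v, hv, hMv⟩ := Matrix.exists_mulVec_eq_zero_iff.2 h0
  have hintegral := momentFunctional_ofCoeffs_mul (jacobiMoment α β γ t) v v
  rw [hMv, dotProduct_zero, momentFunctional_jacobiMoment (by linarith) (by linarith) ht] at hintegral
  have hw : ∀ x ∈ Set.Icc (0:ℝ) 1, 0 ≤ genJacobiWeight α β γ t x := fun x hx =>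
    mul_nonneg (mul_nonneg (Real.rpow_nonneg (by linarith [hx.1]) _) (Real.rpow_nonneg hx.1 _))
      (Real.rpow_nonneg (by linarith [hx.2]) _)
  obtain ⟨y, hy, hpy⟩ : ∃ y ∈ Set.Ioo (0:ℝ) 1, (ofCoeffs v).eval y ≠ 0 := by
    by_contra! hroot
    refine hv (funext fun i => ?_)
    rw [← coeff_ofCoeffs v i, Polynomial.eq_zero_of_infinite_isRoot (ofCoeffs v)
      ((Set.Ioo_infinite zero_lt_one).mono hroot)]
    simp
  refine (intervalIntegral.integral_pos zero_lt_one ?_ ?_ ⟨y, ⟨hy.1.le, hy.2.le⟩, ?_⟩).ne' hintegral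
  · exact (Polynomial.continuous _).continuousOn.mul (continuousOn_genJacobiWeight hα hβ ht)
  · intro x hx
    rw [Polynomial.eval_mul]
    exact mul_nonneg (mul_self_nonneg _) (hw x ⟨hx.1.le, hx.2⟩)
  · rw [Polynomial.eval_mul]
    have h1 : 0 < y - t := by linarith [hy.1]
    have h2 : 0 < 1 - y := by linarith [hy.2]
    have h3 := hy.1
    exact mul_pos (mul_self_pos.2 hpy) (by unfold genJacobiWeight; positivity)

/-- The moments of the generalized Jacobi weight form a Jacobi flow. -/
lemma isJacobiFlow_jacobiMoment {α β γ t : ℝ} (hα : 0 < α) (hβ : 0 < β) (ht : t < 0) :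
    IsJacobiFlow α β γ (fun s => jacobiMoment α β γ s)
      (fun s => ![jacobiMoment (α - 1) β γ s, fun k => -jacobiMoment α (β - 1) γ s k,
        jacobiMoment α β (γ - 1) s]) t := by
  have hα' : -1 < α := by linarith
  have hβ' : -1 < β := by linarith
  have hα1 : -1 < α - 1 := by linarith
  have hβ1 : -1 < β - 1 := by linarith
  have ht1 : 1 - t ≠ 0 := by linarith
  have ht1' : t - 1 ≠ 0 := by linarith
  have hright : ∀ k, jacobiMoment α (β - 1) γ t k
      = (1 - t) * jacobiMoment α (β - 1) (γ - 1) t k - jacobiMoment α β (γ - 1) t k := fun k => by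
    linarith [jacobiMoment_succ_sub_one_mid (γ := γ) hα' hβ1 ht k,
      jacobiMoment_succ_sub_one_right (γ := γ - 1) hα' hβ ht k]
  refine ⟨⟨fun i k => ?_, fun k => ?_⟩, fun k => ?_, fun k => ?_, fun k => ?_, fun k => ?_⟩
  · fin_cases i
    · simpa using jacobiMoment_succ_sub_one_left hα.ne' β γ t k
    · simp [jacobiMoment_succ_sub_one_right hα' hβ ht k]
      ring
    · simpa using jacobiMoment_succ_sub_one_mid hα' hβ' ht k
  · rw [Fin.sum_univ_three]
    simp only [Matrix.cons_val]
    linarith [jacobiMoment_pearson (γ := γ) hα hβ ht k]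
  · exact hasDerivAt_jacobiMoment hα' hβ' ht γ k
  · refine (hasDerivAt_jacobiMoment hα1 hβ' ht γ k).congr_deriv ?_
    simp only [Matrix.cons_val]
    rw [← jacobiMoment_succ_sub_one_left hα.ne' β (γ - 1) t k,
      jacobiMoment_succ_sub_one_mid hα1 hβ' ht k]
    field_simp [ht.ne]
    ring
  · refine (hasDerivAt_jacobiMoment hα' hβ1 ht γ k).neg.congr_deriv ?_
    simp only [Matrix.cons_val]
    rw [hright k]
    field_simp
    ring
  · refine (hasDerivAt_jacobiMoment hα' hβ' ht (γ - 1) k).congr_deriv ?_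
    simp only [Matrix.cons_val]
    have hp := jacobiMoment_pearson (γ := γ - 1) hα hβ ht (k + 1)
    rw [jacobiMoment_succ_sub_one_left hα.ne', jacobiMoment_succ_sub_one_right hα' hβ ht,
      jacobiMoment_succ_sub_one_mid hα' hβ' ht, Nat.add_sub_cancel] at hp
    push_cast at hp
    rw [hright k]
    have ht0 : t ≠ 0 := ht.ne
    field_simp
    linear_combination (t - 1) * hp

end JacobiMoments

theorem statement0
    (α β γ : ℝ) (hα : 0 < α) (hβ : 0 < β) (n : ℕ)
    (hsm : ContDiffOn ℝ (⊤ : ℕ∞) (fun s => Real.log (hankelDet α β γ n s)) (Set.Iio 0))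
    (Ht : ℝ → ℝ)
    (hHt : ∀ t < (0:ℝ),
      Ht t = t * (t - 1) * deriv (fun s => Real.log (hankelDet α β γ n s)) t
        + (-(n * (n + α + β + γ)) - (α + β) ^ 2 / 4) * t
        + (2 * n * (n + α + β + γ) + β * (α + β) - γ * (α - β)) / 4) :
    ∀ t < (0:ℝ),
      deriv Ht t * (t * (t - 1) * deriv (deriv Ht) t) ^ 2
        + (2 * deriv Ht t * (t * deriv Ht t - Ht t) - (deriv Ht t) ^ 2
            - ((α + β) / 2) * ((β - α) / 2) * ((2 * n + α + β) / 2)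
              * ((2 * n + α + β + 2 * γ) / 2)) ^ 2
      = (deriv Ht t + ((α + β) / 2) ^ 2) * (deriv Ht t + ((β - α) / 2) ^ 2)
          * (deriv Ht t + ((2 * n + α + β) / 2) ^ 2)
          * (deriv Ht t + ((2 * n + α + β + 2 * γ) / 2) ^ 2) := by
  rcases Nat.eq_zero_or_pos n with rfl | hn
  · have hlin : ∀ s < 0, Ht s = -((α + β) ^ 2 / 4) * s
        + (β * (α + β) - γ * (α - β)) / 4 := fun s hs => by
      rw [hHt s hs]
      simp [hankelDet]
    have hd1 : ∀ s < 0, deriv Ht s = -((α + β) ^ 2 / 4) := fun s hs => by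
      have := (((hasDerivAt_id s).const_mul (-((α + β) ^ 2 / 4))).add_const
        ((β * (α + β) - γ * (α - β)) / 4)).congr_of_eventuallyEq (f₁ := Ht)
        (Filter.Eventually.mono (Iio_mem_nhds hs) hlin)
      rw [this.deriv, mul_one]
    intro t ht
    have hd2 := (hasDerivAt_const t (-((α + β) ^ 2 / 4))).congr_of_eventuallyEq (f₁ := deriv Ht)
      (Filter.Eventually.mono (Iio_mem_nhds ht) hd1)
    rw [hd2.deriv, hd1 t ht, hlin t ht]
    push_cast
    ring
  · exact fun t ht => IsJacobiFlow.sigmaForm (fun s hs => isJacobiFlow_jacobiMoment hα hβ hs) hn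
      (fun s hs => det_hankelMatrix_jacobiMoment_ne_zero hα hβ hs n) hHt ht
end

section
/- The recurrence coefficient β_n(t) satisfies the first-order differential equation t·(d/dt)β_n(t) = (2 + R_{n−1}(t) − R_n(t))·β_n(t) for all t < 0 and n ≥ 1. -/
open MeasureTheory Real

open Polynomial

section Orthogonality

variable {L : ℝ[X] →ₗ[ℝ] ℝ} {p : ℕ → ℝ[X]} {h : ℕ → ℝ}

/-- An orthogonal sequence of monic polynomials is orthogonal to all polynomials of lower degree. -/
lemma functional_mul_eq_zero_of_degree_lt
    (hp : ∀ n, (p n).Monic ∧ (p n).natDegree = n)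
    (horth : ∀ m n, L (p m * p n) = if m = n then h n else 0)
    {n : ℕ} {q : ℝ[X]} (hq : q.degree < n) : L (p n * q) = 0 := by
  suffices H : ∀ m ≤ n, ∀ q : ℝ[X], q.degree < m → L (p n * q) = 0 from H n le_rfl q hq
  intro m
  induction m with
  | zero =>
    intro _ q hq
    have : q = 0 := by simpa using hq
    simp [this]
  | succ m ih =>
    intro hm q hq
    have hr : (q - C (q.coeff m) * p m).degree < m := by
      rw [degree_lt_iff_coeff_zero] at hq ⊢
      intro k hk
      rcases hk.eq_or_lt with rfl | hk
      · have : (p m).coeff m = 1 := by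
          have := (hp m).1.coeff_natDegree
          rwa [(hp m).2] at this
        simp [this]
      · rw [coeff_sub, coeff_C_mul, hq k hk,
          coeff_eq_zero_of_natDegree_lt (p := p m) (by rw [(hp m).2]; exact hk)]
        simp
    have hdecomp : p n * q = q.coeff m • (p n * p m) + p n * (q - C (q.coeff m) * p m) := by
      rw [smul_eq_C_mul]; ring
    rw [hdecomp, map_add, map_smul, ih (by omega) _ hr, horth, if_neg (by omega)]
    simp

/-- Pairing the `n`-th monic orthogonal polynomial with a polynomial of degree at most `n` only
sees the coefficient of degree `n`. -/
lemma functional_mul_eq_coeff_mul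
    (hp : ∀ n, (p n).Monic ∧ (p n).natDegree = n)
    (horth : ∀ m n, L (p m * p n) = if m = n then h n else 0)
    {n : ℕ} {q : ℝ[X]} (hq : q.natDegree ≤ n) : L (p n * q) = q.coeff n * h n := by
  have hr : (q - C (q.coeff n) * p n).degree < n := by
    rw [degree_lt_iff_coeff_zero]
    intro k hk
    rcases hk.eq_or_lt with rfl | hk
    · have : (p n).coeff n = 1 := by
        have := (hp n).1.coeff_natDegree
        rwa [(hp n).2] at this
      simp [this]
    · rw [coeff_sub, coeff_C_mul, coeff_eq_zero_of_natDegree_lt (p := q) (by omega),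
        coeff_eq_zero_of_natDegree_lt (p := p n) (by rw [(hp n).2]; exact hk)]
      simp
  have hdecomp : p n * q = q.coeff n • (p n * p n) + p n * (q - C (q.coeff n) * p n) := by
    rw [smul_eq_C_mul]; ring
  rw [hdecomp, map_add, map_smul, functional_mul_eq_zero_of_degree_lt hp horth hr, horth,
    if_pos rfl]
  simp

variable {a b : ℕ → ℝ}

/-- The recurrence coefficient `b n` is the ratio of successive squared norms. -/
lemma recurrence_coeff_mul_norm
    (hp : ∀ n, (p n).Monic ∧ (p n).natDegree = n)
    (horth : ∀ m n, L (p m * p n) = if m = n then h n else 0)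
    (hrec : ∀ n, X * p n = p (n + 1) + C (a n) * p n + C (b n) * p (n - 1)) (n : ℕ) :
    b (n + 1) * h n = h (n + 1) := by
  have hXp : (X * p n).Monic := monic_X.mul (hp n).1
  have hdeg : (X * p n).natDegree = n + 1 := by
    rw [natDegree_X_mul (hp n).1.ne_zero, (hp n).2]
  have h₁ : L (p (n + 1) * (X * p n)) = h (n + 1) := by
    rw [functional_mul_eq_coeff_mul hp horth hdeg.le]
    have := hXp.coeff_natDegree
    rw [hdeg] at this
    rw [this, one_mul]
  have hdecomp : p (n + 1) * (X * p n)
      = p (n + 2) * p n + a (n + 1) • (p (n + 1) * p n) + b (n + 1) • (p n * p n) := by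
    have := hrec (n + 1)
    rw [Nat.add_sub_cancel] at this
    rw [smul_eq_C_mul, smul_eq_C_mul]
    linear_combination p n * this
  rw [← h₁, hdecomp]
  simp [horth]

lemma recurrence_diag_mul_norm
    (horth : ∀ m n, L (p m * p n) = if m = n then h n else 0)
    (hb0 : b 0 = 0)
    (hrec : ∀ n, X * p n = p (n + 1) + C (a n) * p n + C (b n) * p (n - 1)) (n : ℕ) :
    a n * h n = L (X * p n * p n) := by
  have hdecomp : X * p n * p n
      = p (n + 1) * p n + a n • (p n * p n) + b n • (p (n - 1) * p n) := by
    rw [smul_eq_C_mul, smul_eq_C_mul]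
    linear_combination p n * hrec n
  rw [hdecomp]
  rcases n with _ | n <;> simp [horth, hb0]

end Orthogonality

section Weight

variable {α β γ t : ℝ}

lemma genJacobiWeight_continuousOn (hα : 0 < α) (hβ : 0 < β) (ht : t < 0) :
    ContinuousOn (genJacobiWeight α β γ t) (Set.Icc 0 1) := by
  unfold genJacobiWeight
  refine ((ContinuousOn.rpow_const (by fun_prop) ?_).mul
    (ContinuousOn.rpow_const (by fun_prop) ?_)).mul (ContinuousOn.rpow_const (by fun_prop) ?_)
  · exact fun x hx => Or.inl (by linarith [hx.1])
  · exact fun x _ => Or.inr hα.le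
  · exact fun x _ => Or.inr hβ.le

lemma eval_mul_genJacobiWeight_intervalIntegrable (hα : 0 < α) (hβ : 0 < β) (ht : t < 0)
    (q : ℝ[X]) :
    IntervalIntegrable (fun x => q.eval x * genJacobiWeight α β γ t x) volume 0 1 := by
  apply ContinuousOn.intervalIntegrable
  rw [Set.uIcc_of_le zero_le_one]
  exact q.continuous.continuousOn.mul (genJacobiWeight_continuousOn hα hβ ht)

lemma eval_mul_genJacobiWeight_div_intervalIntegrable (hα : 0 < α) (hβ : 0 < β) (ht : t < 0)
    (q : ℝ[X]) :
    IntervalIntegrable (fun x => q.eval x * genJacobiWeight α β γ t x / (1 - x)) volume 0 1 := by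
  have hpow : IntervalIntegrable (fun x : ℝ => (1 - x) ^ (β - 1)) volume 0 1 := by
    have := (intervalIntegral.intervalIntegrable_rpow' (a := 1) (b := 0) (r := β - 1)
      (by linarith)).comp_sub_left 1
    simpa using this
  have hcont : ContinuousOn (fun x => q.eval x * ((x - t) ^ γ * x ^ α)) (Set.uIcc 0 1) := by
    rw [Set.uIcc_of_le zero_le_one]
    refine q.continuous.continuousOn.mul ((ContinuousOn.rpow_const (by fun_prop) ?_).mul
      (ContinuousOn.rpow_const (by fun_prop) ?_))
    · exact fun x hx => Or.inl (by linarith [hx.1])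
    · exact fun x _ => Or.inr hα.le
  refine (hpow.continuousOn_mul hcont).congr_uIoo fun x hx => ?_
  rw [Set.uIoo_of_le zero_le_one] at hx
  have hx1 : 1 - x ≠ 0 := by linarith [hx.2]
  simp only [genJacobiWeight, rpow_sub_one hx1]
  ring

/-- Integration against the generalized Jacobi weight, as a linear functional on polynomials. -/
noncomputable def genJacobiFunctional (γ : ℝ) (hα : 0 < α) (hβ : 0 < β) (ht : t < 0) :
    ℝ[X] →ₗ[ℝ] ℝ where
  toFun q := ∫ x in (0:ℝ)..1, q.eval x * genJacobiWeight α β γ t x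
  map_add' p q := by
    rw [← intervalIntegral.integral_add
      (eval_mul_genJacobiWeight_intervalIntegrable hα hβ ht p)
      (eval_mul_genJacobiWeight_intervalIntegrable hα hβ ht q)]
    simp only [eval_add, add_mul]
  map_smul' c q := by
    simp only [eval_smul, smul_eq_mul, mul_assoc, intervalIntegral.integral_const_mul,
      RingHom.id_apply]

lemma genJacobiFunctional_apply (hα : 0 < α) (hβ : 0 < β) (ht : t < 0) (q : ℝ[X]) :
    genJacobiFunctional γ hα hβ ht q = ∫ x in (0:ℝ)..1, q.eval x * genJacobiWeight α β γ t x :=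
  rfl

/-- Differentiation under the integral sign with respect to the singularity `t`. -/
lemma hasDerivAt_integral_genJacobiWeight (hα : 0 < α) (hβ : 0 < β) (ht : t < 0) (q : ℝ[X]) :
    HasDerivAt (fun s => ∫ x in (0:ℝ)..1, q.eval x * genJacobiWeight α β γ s x)
      (-γ * ∫ x in (0:ℝ)..1, q.eval x * genJacobiWeight α β (γ - 1) t x) t := by
  have hneg : ∀ s ∈ Set.Icc (2 * t) (t / 2), s < 0 := fun s hs => by linarith [hs.2]
  obtain ⟨K, hK⟩ := (isCompact_Icc.prod isCompact_Icc :
    IsCompact (Set.Icc (2 * t) (t / 2) ×ˢ Set.Icc (0:ℝ) 1)).exists_bound_of_continuousOn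
    (f := fun z : ℝ × ℝ => -γ * (q.eval z.2 * genJacobiWeight α β (γ - 1) z.1 z.2)) (by
      unfold genJacobiWeight
      refine continuousOn_const.mul ((q.continuous.comp continuous_snd).continuousOn.mul
        (((ContinuousOn.rpow_const (by fun_prop) ?_).mul
        (ContinuousOn.rpow_const (by fun_prop) ?_)).mul
          (ContinuousOn.rpow_const (by fun_prop) ?_)))
      · exact fun z hz => Or.inl (by linarith [hz.2.1, hneg _ hz.1])
      · exact fun z _ => Or.inr hα.le
      · exact fun z _ => Or.inr hβ.le)
  have hmem : Set.Icc (2 * t) (t / 2) ∈ nhds t := Icc_mem_nhds (by linarith) (by linarith)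
  rw [← intervalIntegral.integral_const_mul]
  refine (intervalIntegral.hasDerivAt_integral_of_dominated_loc_of_deriv_le
    (F' := fun s x => -γ * (q.eval x * genJacobiWeight α β (γ - 1) s x))
    (bound := fun _ => K) hmem ?_
    (eval_mul_genJacobiWeight_intervalIntegrable hα hβ ht q) ?_ ?_
    intervalIntegrable_const ?_).2
  · filter_upwards [hmem] with s hs
    exact (eval_mul_genJacobiWeight_intervalIntegrable hα hβ
      (hneg s hs) q).aestronglyMeasurable_restrict_uIoc
  · exact ((eval_mul_genJacobiWeight_intervalIntegrable hα hβ ht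
      q).const_mul (-γ)).aestronglyMeasurable_restrict_uIoc
  · refine .of_forall fun x hx s hs => hK (s, x) ⟨hs, ?_⟩
    rw [Set.uIoc_of_le zero_le_one] at hx
    exact ⟨hx.1.le, hx.2⟩
  · refine .of_forall fun x hx s hs => ?_
    rw [Set.uIoc_of_le zero_le_one] at hx
    have hxs : x - s ≠ 0 := by linarith [hx.1, hneg s hs]
    have hd : HasDerivAt (fun s => (x - s) ^ γ) (-1 * γ * (x - s) ^ (γ - 1)) s :=
      ((hasDerivAt_id s).const_sub x).rpow_const (Or.inl hxs)
    refine (((hd.mul_const (x ^ α)).mul_const ((1 - x) ^ β)).const_mul (q.eval x)).congr_deriv ?_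
    simp only [genJacobiWeight]
    ring

/-- Integration by parts for `x q(x) w(x;t)`, whose boundary values vanish. -/
lemma integral_by_parts_genJacobiWeight (hα : 0 < α) (hβ : 0 < β) (ht : t < 0) (q : ℝ[X]) :
    (∫ x in (0:ℝ)..1, (X * derivative q + C (1 + α + β + γ) * q).eval x
        * genJacobiWeight α β γ t x)
      + γ * t * (∫ x in (0:ℝ)..1, q.eval x * genJacobiWeight α β (γ - 1) t x)
      = β * ∫ x in (0:ℝ)..1, q.eval x * genJacobiWeight α β γ t x / (1 - x) := by
  have i₁ := eval_mul_genJacobiWeight_intervalIntegrable (γ := γ) hα hβ ht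
    (X * derivative q + C (1 + α + β + γ) * q)
  have i₂ := (eval_mul_genJacobiWeight_intervalIntegrable (γ := γ - 1) hα hβ ht q).const_mul (γ * t)
  have i₃ := (eval_mul_genJacobiWeight_div_intervalIntegrable (γ := γ) hα hβ ht q).const_mul β
  have hint := intervalIntegral.integral_eq_sub_of_hasDerivAt_of_le zero_le_one
    (f := fun x => x * q.eval x * genJacobiWeight α β γ t x)
    ((continuous_id.mul q.continuous).continuousOn.mul
      (genJacobiWeight_continuousOn hα hβ ht)) (fun x hx => ?_) ((i₁.add i₂).sub i₃)
  · rw [intervalIntegral.integral_sub (i₁.add i₂) i₃, intervalIntegral.integral_add i₁ i₂,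
      intervalIntegral.integral_const_mul, intervalIntegral.integral_const_mul] at hint
    have hend : genJacobiWeight α β γ t 1 = 0 := by
      simp [genJacobiWeight, zero_rpow hβ.ne']
    rw [hend] at hint
    linarith
  · have hx0 : x ≠ 0 := hx.1.ne'
    have hx1 : 1 - x ≠ 0 := by linarith [hx.2]
    have hxt : x - t ≠ 0 := by linarith [hx.1]
    have d₁ : HasDerivAt (fun x => (x - t) ^ γ) (1 * γ * (x - t) ^ (γ - 1)) x :=
      ((hasDerivAt_id x).sub_const t).rpow_const (Or.inl hxt)
    have d₂ : HasDerivAt (fun x : ℝ => x ^ α) (α * x ^ (α - 1)) x :=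
      hasDerivAt_rpow_const (Or.inl hx0)
    have d₃ : HasDerivAt (fun x : ℝ => (1 - x) ^ β) (-1 * β * (1 - x) ^ (β - 1)) x :=
      ((hasDerivAt_id x).const_sub 1).rpow_const (Or.inl hx1)
    refine (((hasDerivAt_id x).mul (q.hasDerivAt x)).mul ((d₁.mul d₂).mul d₃)).congr_deriv ?_
    simp only [genJacobiWeight, eval_add, eval_mul, eval_X, eval_C, id, rpow_sub_one hx0,
      rpow_sub_one hx1, rpow_sub_one hxt, Pi.mul_apply]
    field_simp
    ring

end Weight

section CoefficientDifferentiability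

/-- A family of polynomials whose coefficients are differentiable at `t`. -/
def CoeffDifferentiableAt (Q : ℝ → ℝ[X]) (t : ℝ) : Prop :=
  ∀ k, DifferentiableAt ℝ (fun s => (Q s).coeff k) t

variable {Q S : ℝ → ℝ[X]} {t : ℝ}

lemma coeffDifferentiableAt_const (q : ℝ[X]) : CoeffDifferentiableAt (fun _ => q) t :=
  fun _ => differentiableAt_const _

lemma DifferentiableAt.coeffDifferentiableAt_C {c : ℝ → ℝ} (hc : DifferentiableAt ℝ c t) :
    CoeffDifferentiableAt (fun s => C (c s)) t := by
  intro k
  by_cases hk : k = 0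
  · simpa [hk] using hc
  · simp [coeff_C, hk]

lemma CoeffDifferentiableAt.mul (hQ : CoeffDifferentiableAt Q t)
    (hS : CoeffDifferentiableAt S t) : CoeffDifferentiableAt (fun s => Q s * S s) t := by
  intro k
  simp only [coeff_mul]
  exact DifferentiableAt.fun_sum fun i _ => (hQ i.1).mul (hS i.2)

lemma CoeffDifferentiableAt.sub (hQ : CoeffDifferentiableAt Q t)
    (hS : CoeffDifferentiableAt S t) : CoeffDifferentiableAt (fun s => Q s - S s) t := by
  intro k
  simp only [coeff_sub]
  exact (hQ k).sub (hS k)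

lemma CoeffDifferentiableAt.congr_of_eventuallyEq (hQ : CoeffDifferentiableAt Q t)
    (h : S =ᶠ[nhds t] Q) : CoeffDifferentiableAt S t :=
  fun k => (hQ k).congr_of_eventuallyEq (h.fun_comp fun q => q.coeff k)

variable {α β γ : ℝ}

lemma integral_eval_mul_genJacobiWeight_eq_sum (hα : 0 < α) (hβ : 0 < β) (ht : t < 0) {q : ℝ[X]}
    {N : ℕ} (hq : q.natDegree < N) :
    ∫ x in (0:ℝ)..1, q.eval x * genJacobiWeight α β γ t x
      = ∑ k ∈ Finset.range N, q.coeff k *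
        ∫ x in (0:ℝ)..1, (X ^ k : ℝ[X]).eval x * genJacobiWeight α β γ t x := by
  simp only [← genJacobiFunctional_apply (γ := γ) hα hβ ht]
  conv_lhs => rw [as_sum_range_C_mul_X_pow' q hq]
  simp only [map_sum, ← smul_eq_C_mul, map_smul, smul_eq_mul]

/-- The integral of a family of polynomials of bounded degree with differentiable coefficients
against the weight is differentiable in the parameter. -/
lemma CoeffDifferentiableAt.integral_genJacobiWeight (hα : 0 < α) (hβ : 0 < β) (ht : t < 0)
    (hQ : CoeffDifferentiableAt Q t) {N : ℕ} (hN : ∀ᶠ s in nhds t, (Q s).natDegree < N) :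
    DifferentiableAt ℝ (fun s => ∫ x in (0:ℝ)..1, (Q s).eval x * genJacobiWeight α β γ s x) t := by
  have hsum : DifferentiableAt ℝ (fun s => ∑ k ∈ Finset.range N, (Q s).coeff k *
      ∫ x in (0:ℝ)..1, (X ^ k : ℝ[X]).eval x * genJacobiWeight α β γ s x) t :=
    DifferentiableAt.fun_sum fun k _ =>
      (hQ k).mul (hasDerivAt_integral_genJacobiWeight hα hβ ht _).differentiableAt
  refine hsum.congr_of_eventuallyEq ?_
  filter_upwards [hN, Iio_mem_nhds ht] with s hs hs0
  exact integral_eval_mul_genJacobiWeight_eq_sum hα hβ hs0 hs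

/-- If the coefficients of `Q s` are differentiable at `t`, the increment of the weight integrated
against `Q s` has the same derivative at `t` as when `Q s` is frozen to `Q t`. -/
lemma CoeffDifferentiableAt.hasDerivAt_integral_sub (hα : 0 < α) (hβ : 0 < β) (ht : t < 0)
    (hQ : CoeffDifferentiableAt Q t) {N : ℕ} (hN : ∀ᶠ s in nhds t, (Q s).natDegree < N) :
    HasDerivAt (fun s => (∫ x in (0:ℝ)..1, (Q s).eval x * genJacobiWeight α β γ s x)
        - ∫ x in (0:ℝ)..1, (Q s).eval x * genJacobiWeight α β γ t x)
      (-γ * ∫ x in (0:ℝ)..1, (Q t).eval x * genJacobiWeight α β (γ - 1) t x) t := by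
  have hsum := HasDerivAt.fun_sum (u := Finset.range N) fun k _ =>
    (hQ k).hasDerivAt.mul
      ((hasDerivAt_integral_genJacobiWeight (γ := γ) hα hβ ht (X ^ k)).sub_const
        (∫ x in (0:ℝ)..1, (X ^ k : ℝ[X]).eval x * genJacobiWeight α β γ t x))
  refine (hsum.congr_of_eventuallyEq ?_).congr_deriv ?_
  · filter_upwards [hN, Iio_mem_nhds ht] with s hs hs0
    rw [integral_eval_mul_genJacobiWeight_eq_sum hα hβ hs0 hs,
      integral_eval_mul_genJacobiWeight_eq_sum hα hβ ht hs, ← Finset.sum_sub_distrib]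
    simp only [Pi.mul_apply, mul_sub]
  · rw [integral_eval_mul_genJacobiWeight_eq_sum hα hβ ht hN.self_of_nhds, Finset.mul_sum]
    exact Finset.sum_congr rfl fun k _ => by ring

end CoefficientDifferentiability

section Evolution

variable {α β γ : ℝ} {P : ℝ → ℕ → ℝ[X]} {h a b : ℝ → ℕ → ℝ}

lemma genJacobiFunctional_orthogonal (hα : 0 < α) (hβ : 0 < β)
    (horth : ∀ t < (0:ℝ), ∀ m n, (∫ x in (0:ℝ)..1,
        (P t m).eval x * (P t n).eval x * genJacobiWeight α β γ t x)
      = if m = n then h t n else 0) {t : ℝ} (ht : t < 0) (m n : ℕ) :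
    genJacobiFunctional γ hα hβ ht (P t m * P t n) = if m = n then h t n else 0 := by
  simp only [genJacobiFunctional_apply, eval_mul, horth t ht]

/-- The coefficients of the orthogonal polynomials depend differentiably on the parameter. -/
lemma coeffDifferentiableAt_orthogonal (hα : 0 < α) (hβ : 0 < β)
    (hmonic : ∀ t < (0:ℝ), ∀ n, (P t n).Monic ∧ (P t n).natDegree = n)
    (hpos : ∀ t < (0:ℝ), ∀ n, 0 < h t n)
    (horth : ∀ t < (0:ℝ), ∀ m n, (∫ x in (0:ℝ)..1,
        (P t m).eval x * (P t n).eval x * genJacobiWeight α β γ t x)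
      = if m = n then h t n else 0)
    (hb0 : ∀ t < (0:ℝ), b t 0 = 0)
    (hrec : ∀ t < (0:ℝ), ∀ n,
      X * P t n = P t (n + 1) + C (a t n) * P t n + C (b t n) * P t (n - 1))
    {t : ℝ} (ht : t < 0) (n : ℕ) : CoeffDifferentiableAt (fun s => P s n) t := by
  have hnhds : Set.Iio (0:ℝ) ∈ nhds t := Iio_mem_nhds ht
  induction n using Nat.strong_induction_on with
  | _ n ih =>
  rcases n with _ | n
  · refine (coeffDifferentiableAt_const 1).congr_of_eventuallyEq ?_
    filter_upwards [hnhds] with s hs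
    exact (hmonic s hs 0).1.natDegree_eq_zero.1 (hmonic s hs 0).2
  have hnorm : ∀ m < n + 1, DifferentiableAt ℝ (fun s => h s m) t := by
    intro m hm
    refine (((ih m hm).mul (ih m hm)).integral_genJacobiWeight (γ := γ) hα hβ ht
      (N := m + m + 1) ?_).congr_of_eventuallyEq ?_
    · filter_upwards [hnhds] with s hs
      have := natDegree_mul_le (p := P s m) (q := P s m)
      rw [(hmonic s hs m).2] at this
      omega
    · filter_upwards [hnhds] with s hs
      simp only [eval_mul, horth s hs m m, if_true]
  have hdiffa : DifferentiableAt ℝ (fun s => a s n) t := by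
    have hP := ih n n.lt_succ_self
    refine (((((coeffDifferentiableAt_const X).mul hP).mul hP).integral_genJacobiWeight (γ := γ)
      hα hβ ht (N := n + n + 2) ?_).div (hnorm n n.lt_succ_self)
        (hpos t ht n).ne').congr_of_eventuallyEq ?_
    · filter_upwards [hnhds] with s hs
      have h₁ := natDegree_mul_le (p := X * P s n) (q := P s n)
      have h₂ := natDegree_mul_le (p := X) (q := P s n)
      rw [(hmonic s hs n).2] at h₁ h₂
      rw [natDegree_X] at h₂
      omega
    · filter_upwards [hnhds] with s hs
      exact eq_div_of_mul_eq (hpos s hs n).ne' (recurrence_diag_mul_norm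
        (genJacobiFunctional_orthogonal hα hβ horth hs) (hb0 s hs) (hrec s hs) n)
  have hdiffb : DifferentiableAt ℝ (fun s => b s n) t := by
    rcases n with _ | m
    · refine (differentiableAt_const (0:ℝ)).congr_of_eventuallyEq ?_
      filter_upwards [hnhds] with s hs using hb0 s hs
    · refine ((hnorm (m + 1) (by omega)).div (hnorm m (by omega))
        (hpos t ht m).ne').congr_of_eventuallyEq ?_
      filter_upwards [hnhds] with s hs
      exact eq_div_of_mul_eq (hpos s hs m).ne' (recurrence_coeff_mul_norm (hmonic s hs)
        (genJacobiFunctional_orthogonal hα hβ horth hs) (hrec s hs) m)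
  refine ((((coeffDifferentiableAt_const X).sub hdiffa.coeffDifferentiableAt_C).mul
    (ih n n.lt_succ_self)).sub (hdiffb.coeffDifferentiableAt_C.mul
      (ih (n - 1) (by omega)))).congr_of_eventuallyEq ?_
  filter_upwards [hnhds] with s hs
  linear_combination -hrec s hs n

/-- The evolution of the squared norms: only the weight contributes to the derivative. -/
lemma hasDerivAt_norm_sq (hα : 0 < α) (hβ : 0 < β)
    (hmonic : ∀ t < (0:ℝ), ∀ n, (P t n).Monic ∧ (P t n).natDegree = n)
    (horth : ∀ t < (0:ℝ), ∀ m n, (∫ x in (0:ℝ)..1,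
        (P t m).eval x * (P t n).eval x * genJacobiWeight α β γ t x)
      = if m = n then h t n else 0)
    {t : ℝ} (ht : t < 0) {n : ℕ} (hP : CoeffDifferentiableAt (fun s => P s n) t) :
    HasDerivAt (fun s => h s n)
      (-γ * ∫ x in (0:ℝ)..1, (P t n * P t n).eval x * genJacobiWeight α β (γ - 1) t x) t := by
  have hnhds : Set.Iio (0:ℝ) ∈ nhds t := Iio_mem_nhds ht
  have hlead : ∀ s < 0, (P s n).coeff n = 1 := fun s hs => by
    have := (hmonic s hs n).1.coeff_natDegree
    rwa [(hmonic s hs n).2] at this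
  have hd := (hP.mul (coeffDifferentiableAt_const (P t n))).hasDerivAt_integral_sub (γ := γ)
    hα hβ ht (N := n + n + 1) (by
      filter_upwards [hnhds] with s hs
      have := natDegree_mul_le (p := P s n) (q := P t n)
      rw [(hmonic s hs n).2, (hmonic t ht n).2] at this
      omega)
  refine (hd.add_const (h t n)).congr_of_eventuallyEq ?_
  filter_upwards [hnhds] with s hs
  rw [Set.mem_Iio] at hs
  have h₁ : genJacobiFunctional γ hα hβ hs (P s n * P t n) = h s n := by
    rw [functional_mul_eq_coeff_mul (hmonic s hs) (genJacobiFunctional_orthogonal hα hβ horth hs)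
      (hmonic t ht n).2.le, hlead t ht, one_mul]
  have h₂ : genJacobiFunctional γ hα hβ ht (P s n * P t n) = h t n := by
    rw [mul_comm, functional_mul_eq_coeff_mul (hmonic t ht)
      (genJacobiFunctional_orthogonal hα hβ horth ht) (hmonic s hs n).2.le, hlead s hs, one_mul]
  rw [genJacobiFunctional_apply] at h₁ h₂
  rw [h₁, h₂]
  ring

/-- Integration by parts expresses the derivative of the squared norm through the integral of
`P_n² w / (1 - y)`. -/
lemma mul_deriv_norm_sq_eq (hα : 0 < α) (hβ : 0 < β)
    (hmonic : ∀ t < (0:ℝ), ∀ n, (P t n).Monic ∧ (P t n).natDegree = n)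
    (horth : ∀ t < (0:ℝ), ∀ m n, (∫ x in (0:ℝ)..1,
        (P t m).eval x * (P t n).eval x * genJacobiWeight α β γ t x)
      = if m = n then h t n else 0)
    {t : ℝ} (ht : t < 0) (n : ℕ) :
    t * (-γ * ∫ x in (0:ℝ)..1, (P t n * P t n).eval x * genJacobiWeight α β (γ - 1) t x)
      = (2 * n + 1 + α + β + γ) * h t n
        - β * ∫ y in (0:ℝ)..1, ((P t n).eval y) ^ 2 * genJacobiWeight α β γ t y / (1 - y) := by
  have hparts := integral_by_parts_genJacobiWeight (γ := γ) hα hβ ht (P t n * P t n)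
  have horth' := genJacobiFunctional_orthogonal hα hβ horth ht
  rw [← genJacobiFunctional_apply hα hβ ht] at hparts
  have hdeg : (X * derivative (P t n)).natDegree ≤ n := by
    refine natDegree_le_iff_coeff_eq_zero.2 fun k hk => ?_
    obtain ⟨k, rfl⟩ := Nat.exists_eq_succ_of_ne_zero (Nat.ne_of_gt (by omega : 0 < k))
    rw [Nat.succ_eq_add_one, coeff_X_mul, coeff_derivative,
      coeff_eq_zero_of_natDegree_lt (by rw [(hmonic t ht n).2]; exact hk), zero_mul]
  have hcoeff : (X * derivative (P t n)).coeff n = (n : ℝ) := by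
    have hlead := (hmonic t ht n).1.coeff_natDegree
    rw [(hmonic t ht n).2] at hlead
    rcases n with _ | n
    · simp
    · rw [coeff_X_mul, coeff_derivative, hlead]
      push_cast
      ring
  have hdecomp : X * derivative (P t n * P t n) + C (1 + α + β + γ) * (P t n * P t n)
      = (2:ℝ) • (P t n * (X * derivative (P t n))) + (1 + α + β + γ) • (P t n * P t n) := by
    rw [derivative_mul, smul_eq_C_mul, smul_eq_C_mul, map_ofNat]
    ring
  rw [hdecomp, map_add, map_smul, map_smul,
    functional_mul_eq_coeff_mul (hmonic t ht) horth' hdeg, horth', hcoeff, if_pos rfl] at hparts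
  have hsq : ∀ y, (P t n * P t n).eval y * genJacobiWeight α β γ t y / (1 - y)
      = ((P t n).eval y) ^ 2 * genJacobiWeight α β γ t y / (1 - y) := fun y => by
    rw [eval_mul, sq]
  simp only [hsq, smul_eq_mul] at hparts
  linear_combination -hparts

end Evolution

theorem statement1
    (α β γ : ℝ) (hα : 0 < α) (hβ : 0 < β)
    (P : ℝ → ℕ → Polynomial ℝ) (h : ℝ → ℕ → ℝ)
    (hmonic : ∀ t < (0:ℝ), ∀ n, (P t n).Monic ∧ (P t n).natDegree = n)
    (hpos : ∀ t < (0:ℝ), ∀ n, 0 < h t n)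
    (horth : ∀ t < (0:ℝ), ∀ m n, (∫ x in (0:ℝ)..1,
        (P t m).eval x * (P t n).eval x * genJacobiWeight α β γ t x)
      = if m = n then h t n else 0)
    (a b : ℝ → ℕ → ℝ) (hb0 : ∀ t < (0:ℝ), b t 0 = 0)
    (hrec : ∀ t < (0:ℝ), ∀ n, ∀ x : ℝ, x * (P t n).eval x
      = (P t (n + 1)).eval x + a t n * (P t n).eval x + b t n * (P t (n - 1)).eval x)
    (R : ℝ → ℕ → ℝ)
    (hR : ∀ t < (0:ℝ), ∀ n, R t n = β / h t n *
      ∫ y in (0:ℝ)..1, ((P t n).eval y) ^ 2 * genJacobiWeight α β γ t y / (1 - y))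
    :
    ∀ n : ℕ, 1 ≤ n → ∀ t < (0:ℝ),
      t * deriv (fun s => b s n) t = (2 + R t (n - 1) - R t n) * b t n := by
  intro n hn t ht
  obtain ⟨m, rfl⟩ : ∃ m, n = m + 1 := ⟨n - 1, by omega⟩
  rw [Nat.add_sub_cancel]
  have hrecX : ∀ t < (0:ℝ), ∀ n,
      X * P t n = P t (n + 1) + C (a t n) * P t n + C (b t n) * P t (n - 1) := fun s hs k =>
    Polynomial.funext fun x => by simpa using hrec s hs k x
  have hratio : ∀ s < (0:ℝ), b s (m + 1) = h s (m + 1) / h s m := fun s hs =>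
    eq_div_of_mul_eq (hpos s hs m).ne' (recurrence_coeff_mul_norm (hmonic s hs)
      (genJacobiFunctional_orthogonal hα hβ horth hs) (hrecX s hs) m)
  have hderiv := fun k => hasDerivAt_norm_sq hα hβ hmonic horth ht
    (coeffDifferentiableAt_orthogonal hα hβ hmonic hpos horth hb0 hrecX ht k)
  have hnorm : ∀ k, t * (-γ * ∫ x in (0:ℝ)..1,
      (P t k * P t k).eval x * genJacobiWeight α β (γ - 1) t x)
      = (2 * k + 1 + α + β + γ - R t k) * h t k := fun k => by
    have hk := (hpos t ht k).ne'
    rw [mul_deriv_norm_sq_eq hα hβ hmonic horth ht k, hR t ht k]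
    field_simp
  have hm := (hpos t ht m).ne'
  have hb := ((hderiv (m + 1)).div (hderiv m) hm).congr_of_eventuallyEq
    (f₁ := fun s => b s (m + 1)) (by
      filter_upwards [Iio_mem_nhds ht] with s hs using hratio s hs)
  rw [hb.deriv, hratio t ht, mul_div_assoc', mul_div_assoc', div_eq_div_iff (pow_ne_zero 2 hm) hm]
  have h₁ := hnorm (m + 1)
  have h₂ := hnorm m
  push_cast at h₁
  linear_combination h t m ^ 2 * h₁ - h t m * h t (m + 1) * h₂
end
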